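/- Let μ' be any Borel probability measure on (0,1) that is absolutely continuous with respect to Lebesgue measure, and set C₀ = 2/log(2+√3). Then for every y > 0, lim_{N→∞} μ'{ x ∈ (0,1) irrational : max_{1≤n≤N} a_n(x) ≤ C₀ N y } = exp(−1/y). -/

import Mathlib

open MeasureTheory Real Set Filter Topology

namespace SCF

/-- The involution `ι(x) = (1−x)/(1+x)`. -/
noncomputable def iota (x : ℝ) : ℝ := (1 - x) / (1 + x)

/-- Even continued-fraction step.  For `y ∈ (0,1/2]` one has
`⌊(1/y+1)/2⌋ = k` whenever `1/y ∈ (2k−1, 2k+1)`, so `Te y = |1/y − 2k|`;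
explicitly `Te y = 1/y − 2` on `[1/3,1/2]`, `Te y = 1/y − 2k` on
`[1/(2k+1), 1/(2k))` and `Te y = 2k − 1/y` on `[1/(2k), 1/(2k−1))` (`k ≥ 2`). -/
noncomputable def Te (y : ℝ) : ℝ := |1 / y - 2 * (⌊(1 / y + 1) / 2⌋ : ℝ)|

/-- The spliced continued fraction (SCF) map `T : [0,1] → [0,1]`, with
`T 0 = 0`, `T 1 = 1`.  On `(0,1/2]` it is the even continued fraction map
(see `Te`), and on `(1/2,1)` it is the odd–odd map, which is the conjugate
`ι ∘ Te ∘ ι` of the even map; this agrees with the branchwise definition: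
`T x = (k x − (k−1))/(k − (k+1) x)` on `((k−1)/k, (2k−1)/(2k+1)]` and
`T x = (k − (k+1) x)/(k x − (k−1))` on `((2k−1)/(2k+1), k/(k+1)]` for `k ≥ 2`. -/
noncomputable def T (x : ℝ) : ℝ :=
  if x ≤ 0 then 0
  else if 1 ≤ x then 1
  else if x ≤ 1 / 2 then Te x
  else iota (Te (iota x))

/-- Parity label of a digit: `e` (even cusp) or `o` (odd–odd cusp). -/
inductive Par | e | o
deriving DecidableEq

/-- A candidate SCF digit `(a, ε)_s`. -/
structure Digit where
  a : ℤ
  eps : ℤ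
  s : Par
deriving DecidableEq

/-- The digit set `𝒜 = {(k,ε)_s : k ≥ 2, ε = ±1, s ∈ {e,o}} ∪ {(1,+1)_e}`. -/
def Digit.Valid (d : Digit) : Prop :=
  (2 ≤ d.a ∧ (d.eps = 1 ∨ d.eps = -1)) ∨ (d.a = 1 ∧ d.eps = 1 ∧ d.s = Par.e)

/-- The branch intervals `I_{(a,ε)_s}` of the SCF map. -/
noncomputable def branch (d : Digit) : Set ℝ :=
  match d.s with
  | Par.e =>
      if d.a = 1 then Set.Icc (1/3 : ℝ) (1/2)
      else if d.eps = 1 then Set.Ico (1 / (2 * (d.a : ℝ) + 1)) (1 / (2 * (d.a : ℝ)))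
      else Set.Ico (1 / (2 * (d.a : ℝ))) (1 / (2 * (d.a : ℝ) - 1))
  | Par.o =>
      if d.eps = 1 then
        Set.Ioc ((2 * (d.a : ℝ) - 1) / (2 * (d.a : ℝ) + 1)) ((d.a : ℝ) / ((d.a : ℝ) + 1))
      else
        Set.Ioc (((d.a : ℝ) - 1) / (d.a : ℝ)) ((2 * (d.a : ℝ) - 1) / (2 * (d.a : ℝ) + 1))

open Classical in
/-- The SCF digit of a point `y` (the unique valid digit `d` with `y ∈ I_d`;
well defined for every `y ∈ (0,1)`). -/
noncomputable def digit (y : ℝ) : Digit :=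
  if h : ∃ d : Digit, d.Valid ∧ y ∈ branch d then h.choose else ⟨1, 1, Par.e⟩

/-- The `n`-th SCF digit `(a_n(x), ε_n(x))_{s_n(x)}` of `x`, `n ≥ 1`,
determined by `T^[n−1] x ∈ I_{(a_n,ε_n)_{s_n}}`. -/
noncomputable def dig (n : ℕ) (x : ℝ) : Digit := digit (T^[n - 1] x)

/-- The `n`-th SCF partial quotient `a_n(x)`. -/
noncomputable def a (n : ℕ) (x : ℝ) : ℤ := (dig n x).a

/-- The invariant density `f_μ`. -/
noncomputable def fdens (x : ℝ) : ℝ :=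
  2 / (Real.log (2 + Real.sqrt 3) * (1 - (2 - Real.sqrt 3) * x) * (1 + Real.sqrt 3 * x))

/-- The absolutely continuous `T`-invariant probability measure `μ` on `(0,1)`. -/
noncomputable def mu : Measure ℝ :=
  (volume.restrict (Set.Ioo (0 : ℝ) 1)).withDensity fun x => ENNReal.ofReal (fdens x)

/-- The inverse branches `h_{(a,ε)_s}` of the SCF map `T`. -/
noncomputable def h (d : Digit) (x : ℝ) : ℝ :=
  match d.s with
  | Par.e => 1 / (2 * (d.a : ℝ) + (d.eps : ℝ) * x)
  | Par.o =>
      if d.eps = 1 then (((d.a : ℝ) - 1) * x + (d.a : ℝ)) / ((d.a : ℝ) * x + ((d.a : ℝ) + 1))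
      else ((d.a : ℝ) * x + ((d.a : ℝ) - 1)) / (((d.a : ℝ) + 1) * x + (d.a : ℝ))

/-- Composed inverse branch `h_{A^{(n)}} = h_{A₁} ∘ ⋯ ∘ h_{A_n}` of a word. -/
noncomputable def hWord (l : List Digit) : ℝ → ℝ :=
  l.foldr (fun d g => h d ∘ g) id

/-- The dual inverse branches `bar h_{(b,η)_t}`. -/
noncomputable def hbar (d : Digit) (y : ℝ) : ℝ :=
  match d.s with
  | Par.e => (d.eps : ℝ) / (2 * (d.a : ℝ) + y)
  | Par.o =>
      1 / (1 + (d.eps : ℝ) / (((d.a : ℝ) - ((max 0 d.eps : ℤ) : ℝ)) + 1 / (1 + y)))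

/-- The matrix `M_{(a,ε)_s}` associated with the inverse branch `h_{(a,ε)_s}`. -/
noncomputable def Mdig (d : Digit) : Matrix (Fin 2) (Fin 2) ℝ :=
  match d.s with
  | Par.e => !![0, 1; (d.eps : ℝ), 2 * (d.a : ℝ)]
  | Par.o =>
      !![(d.a : ℝ) - ((max 0 d.eps : ℤ) : ℝ), (d.a : ℝ) - ((max 0 d.eps : ℤ) : ℝ) + (d.eps : ℝ);
         (d.a : ℝ) - ((max 0 d.eps : ℤ) : ℝ) + 1, (d.a : ℝ) - ((max 0 d.eps : ℤ) : ℝ) + (d.eps : ℝ) + 1]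

/-- `M_n(x) = M_{(a₁,ε₁)_{s₁}} ⋯ M_{(a_n,ε_n)_{s_n}}`. -/
noncomputable def Mn (n : ℕ) (x : ℝ) : Matrix (Fin 2) (Fin 2) ℝ :=
  ((List.range n).map fun i => Mdig (digit (T^[i] x))).prod

/-- `P_n(x)`: the `(1,2)`-entry of `M_n(x)` (numerator of the `n`-th convergent). -/
noncomputable def Pc (n : ℕ) (x : ℝ) : ℝ := Mn n x 0 1

/-- `Q_n(x)`: the `(2,2)`-entry of `M_n(x)` (denominator of the `n`-th convergent). -/
noncomputable def Qc (n : ℕ) (x : ℝ) : ℝ := Mn n x 1 1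



/-! ### Branch combinatorics -/

lemma valid_a_pos {d : Digit} (hd : d.Valid) : 1 ≤ d.a := by
  rcases hd with ⟨h1, _⟩ | ⟨h1, _⟩ <;> omega

lemma valid_eps {d : Digit} (hd : d.Valid) : d.eps = 1 ∨ d.eps = -1 := by
  rcases hd with ⟨_, h1⟩ | ⟨_, h1, _⟩
  · exact h1
  · exact Or.inl h1

/-- The real number whose integer part encodes the digit. -/
noncomputable def code (y : ℝ) : ℝ := if y ≤ 1 / 2 then 1 / y else 1 / iota y

/-- The inner variable: `x` for even digits, `iota x` for odd ones. -/
noncomputable def inner (s : Par) (x : ℝ) : ℝ := match s with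
  | Par.e => x
  | Par.o => iota x

lemma iota_mem {x : ℝ} (hx : x ∈ Ioo (0 : ℝ) 1) : iota x ∈ Ioo (0 : ℝ) 1 := by
  obtain ⟨h0, h1⟩ := hx
  unfold iota
  constructor
  · apply div_pos <;> linarith
  · rw [div_lt_one (by linarith)]; linarith

lemma iota_iota {x : ℝ} (hx : 0 < x) : iota (iota x) = x := by
  unfold iota
  have : 1 + x ≠ 0 := by positivity
  field_simp
  ring

lemma inner_mem {s : Par} {x : ℝ} (hx : x ∈ Ioo (0 : ℝ) 1) : inner s x ∈ Ioo (0 : ℝ) 1 := by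
  cases s
  · exact hx
  · exact iota_mem hx

lemma a_ge_one_real {d : Digit} (hd : d.Valid) : (1 : ℝ) ≤ d.a := by
  exact_mod_cast valid_a_pos hd

lemma a_ge_two_real {d : Digit} (hd : d.Valid) (h : d.s = Par.o ∨ d.eps = -1) :
    (2 : ℝ) ≤ d.a := by
  rcases hd with ⟨h1, _⟩ | ⟨_, h2, h3⟩
  · exact_mod_cast h1
  · rcases h with h | h
    · rw [h3] at h; cases h
    · omega

/-- Position of `h d x`. -/
lemma h_pos_side {d : Digit} (hd : d.Valid) {x : ℝ} (hx : x ∈ Ioo (0 : ℝ) 1) :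
    h d x ∈ Ioo (0 : ℝ) 1 ∧ (d.s = Par.e → h d x ≤ 1 / 2) ∧ (d.s = Par.o → 1 / 2 < h d x) := by
  obtain ⟨h0, h1⟩ := hx
  have ha := a_ge_one_real hd
  have ha2 := a_ge_two_real hd
  have he := valid_eps hd
  obtain ⟨k, ε, s⟩ := d
  simp only at ha ha2 he
  cases s
  · simp only [h]
    have : (2 : ℝ) ≤ 2 * k + ε * x := by
      rcases he with rfl | rfl
      · push_cast; nlinarith
      · have := ha2 (Or.inr rfl); push_cast; nlinarith
    refine ⟨⟨by positivity, ?_⟩, fun _ => ?_, fun h => by cases h⟩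
    · rw [div_lt_one (by linarith)]; linarith
    · exact one_div_le_one_div_of_le (by norm_num) this
  · have hk := ha2 (Or.inl rfl)
    simp only [h]
    rcases he with rfl | rfl
    · simp only [if_true]
      have hp : (0 : ℝ) < k * x + (k + 1) := by positivity
      have h2 : 1 / 2 < ((k - 1) * x + k) / (k * x + (k + 1) : ℝ) := by
        rw [lt_div_iff₀ hp]; nlinarith
      refine ⟨⟨by linarith, ?_⟩, fun h => (by cases h), fun _ => h2⟩
      rw [div_lt_one hp]; nlinarith
    · rw [if_neg (by norm_num)]
      have hp : (0 : ℝ) < (k + 1) * x + k := by positivity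
      have h2 : 1 / 2 < (k * x + (k - 1)) / ((k + 1) * x + k : ℝ) := by
        rw [lt_div_iff₀ hp]; nlinarith
      refine ⟨⟨by linarith, ?_⟩, fun h => (by cases h), fun _ => h2⟩
      rw [div_lt_one hp]; nlinarith

lemma code_h {d : Digit} (hd : d.Valid) {x : ℝ} (hx : x ∈ Ioo (0 : ℝ) 1) :
    code (h d x) = 2 * (d.a : ℝ) + d.eps * inner d.s x := by
  obtain ⟨hm, hse, hso⟩ := h_pos_side hd hx
  obtain ⟨h0, h1⟩ := hx
  have ha := a_ge_one_real hd
  have ha2 := a_ge_two_real hd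
  have he := valid_eps hd
  obtain ⟨k, ε, s⟩ := d
  simp only at ha ha2 he hm hse hso
  cases s
  · simp only [code, if_pos (hse rfl)]
    simp [h, inner]
  · have := hso rfl
    have hk := ha2 (Or.inl rfl)
    rw [code, if_neg (by linarith)]
    simp only [inner, iota]
    simp only [h]
    rcases he with rfl | rfl
    · simp only [if_true]
      have hp : (0 : ℝ) < k * x + (k + 1) := by positivity
      have e1 : (1 : ℝ) - ((k - 1) * x + k) / (k * x + (k + 1)) = (x + 1) / (k * x + (k + 1)) := by
        field_simp; ring
      have e2 : (1 : ℝ) + ((k - 1) * x + k) / (k * x + (k + 1))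
          = ((2 * k - 1) * x + (2 * k + 1)) / (k * x + (k + 1)) := by
        field_simp; ring
      rw [e1, e2, div_div_div_cancel_right₀ hp.ne', one_div_div]
      have : (1 + x) ≠ 0 := by positivity
      have : (x + 1) ≠ 0 := by positivity
      push_cast
      field_simp
      ring
    · rw [if_neg (by norm_num)]
      have hp : (0 : ℝ) < (k + 1) * x + k := by positivity
      have e1 : (1 : ℝ) - (k * x + (k - 1)) / ((k + 1) * x + k) = (x + 1) / ((k + 1) * x + k) := by
        field_simp; ring
      have e2 : (1 : ℝ) + (k * x + (k - 1)) / ((k + 1) * x + k)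
          = ((2 * k + 1) * x + (2 * k - 1)) / ((k + 1) * x + k) := by
        field_simp; ring
      rw [e1, e2, div_div_div_cancel_right₀ hp.ne', one_div_div]
      have : (1 + x) ≠ 0 := by positivity
      have : (x + 1) ≠ 0 := by positivity
      push_cast
      field_simp
      ring

lemma floor_code (k ε : ℤ) (hε : ε = 1 ∨ ε = -1) {t : ℝ} (ht : t ∈ Ioo (0 : ℝ) 1) :
    ⌊((2 * (k : ℝ) + ε * t) + 1) / 2⌋ = k := by
  obtain ⟨h0, h1⟩ := ht
  rw [Int.floor_eq_iff]
  rcases hε with rfl | rfl <;> push_cast <;> constructor <;> linarith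

lemma abs_eps (k ε : ℤ) (hε : ε = 1 ∨ ε = -1) {t : ℝ} (ht : t ∈ Ioo (0 : ℝ) 1) :
    |(2 * (k : ℝ) + ε * t) - 2 * (k : ℝ)| = t := by
  obtain ⟨h0, h1⟩ := ht
  rcases hε with rfl | rfl <;> push_cast
  · rw [show 2 * (k : ℝ) + 1 * t - 2 * k = t by ring, abs_of_pos h0]
  · rw [show 2 * (k : ℝ) + -1 * t - 2 * k = -t by ring, abs_neg, abs_of_pos h0]

lemma T_eq_code {y : ℝ} (hy : y ∈ Ioo (0 : ℝ) 1) {k ε : ℤ} (hε : ε = 1 ∨ ε = -1) {t : ℝ}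
    (ht : t ∈ Ioo (0 : ℝ) 1) (hc : code y = 2 * (k : ℝ) + ε * t) :
    T y = if y ≤ 1 / 2 then t else iota t := by
  rw [T, if_neg (by linarith [hy.1]), if_neg (by linarith [hy.2])]
  rw [code] at hc
  split_ifs with hh
  · rw [if_pos hh] at hc
    rw [Te, hc, floor_code k ε hε ht, abs_eps k ε hε ht]
  · rw [if_neg hh] at hc
    rw [Te, hc, floor_code k ε hε ht, abs_eps k ε hε ht]

lemma T_h {d : Digit} (hd : d.Valid) {x : ℝ} (hx : x ∈ Ioo (0 : ℝ) 1) : T (h d x) = x := by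
  obtain ⟨hm, hse, hso⟩ := h_pos_side hd hx
  rw [T_eq_code hm (valid_eps hd) (inner_mem hx) (code_h hd hx)]
  obtain ⟨k, ε, s⟩ := d
  cases s
  · rw [if_pos (hse rfl)]; rfl
  · rw [if_neg (by linarith [hso rfl])]
    exact iota_iota hx.1

lemma h_injOn {d : Digit} (hd : d.Valid) : InjOn (h d) (Ioo 0 1) := by
  intro x hx y hy hxy
  rw [← T_h hd hx, ← T_h hd hy, hxy]

/-- A point of a branch: side and code range. -/
lemma branch_code {d : Digit} (hd : d.Valid) {y : ℝ} (hy : y ∈ branch d) :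
    (d.s = Par.e ↔ y ≤ 1 / 2) ∧
    ((d.eps = 1 ∧ 2 * (d.a : ℝ) ≤ code y ∧ code y ≤ 2 * d.a + 1) ∨
      (d.eps = -1 ∧ 2 * (d.a : ℝ) - 1 ≤ code y ∧ code y ≤ 2 * d.a)) := by
  have ha := a_ge_one_real hd
  have ha2 := a_ge_two_real hd
  have he := valid_eps hd
  have hv := hd
  obtain ⟨k, ε, s⟩ := d
  simp only at ha ha2 he
  cases s
  · simp only [branch] at hy
    have key : ∀ l u : ℝ, 0 < l → 2 ≤ l → 1 / u ≤ y → y ≤ 1 / l → 0 < u →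
        y ≤ 1 / 2 ∧ l ≤ code y ∧ code y ≤ u := by
      intro l u hl hl2 h1 h2 hu
      have hy0 : 0 < y := lt_of_lt_of_le (by positivity) h1
      have : y ≤ 1 / 2 := h2.trans (one_div_le_one_div_of_le (by norm_num) hl2)
      refine ⟨this, ?_, ?_⟩ <;> rw [code, if_pos this]
      · rw [le_one_div hl hy0]; exact h2
      · rw [one_div_le hy0 hu]; exact h1
    by_cases hk1 : k = 1
    · subst hk1
      simp only [if_true] at hy
      have hε : ε = 1 := by
        rcases hv with ⟨h1, _⟩ | ⟨_, h1, _⟩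
        · simp at h1
        · exact h1
      have := key 2 3 (by norm_num) le_rfl (by linarith [hy.1]) hy.2 (by norm_num)
      refine ⟨by simpa using this.1, Or.inl ⟨hε, ?_, ?_⟩⟩ <;> push_cast <;> linarith [this.2.1, this.2.2]
    · rw [if_neg hk1] at hy
      rcases he with rfl | rfl
      · simp only [if_true] at hy
        have := key (2 * k) (2 * k + 1) (by linarith) (by linarith) hy.1 hy.2.le (by linarith)
        exact ⟨by simpa using this.1, Or.inl ⟨rfl, this.2⟩⟩
      · rw [if_neg (by norm_num)] at hy
        have hk := ha2 (Or.inr rfl)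
        have := key (2 * k - 1) (2 * k) (by linarith) (by linarith) hy.1 hy.2.le (by linarith)
        exact ⟨by simpa using this.1, Or.inr ⟨rfl, this.2⟩⟩
  · have hk := ha2 (Or.inl rfl)
    simp only [branch] at hy
    have key : ∀ l u : ℝ, 3 ≤ l → l ≤ u → (l - 1) / (l + 1) ≤ y → y ≤ (u - 1) / (u + 1) → 1 / 2 < y →
        l ≤ code y ∧ code y ≤ u := by
      intro l u hl hlu h1 h2 h3
      rw [code, if_neg (by linarith), iota, one_div_div]
      rw [div_le_iff₀ (by linarith)] at h1
      rw [le_div_iff₀ (by linarith)] at h2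
      have : 0 < 1 - y := by
        by_contra hc
        nlinarith
      rw [le_div_iff₀ this, div_le_iff₀ this]
      constructor <;> nlinarith
    have hko : (0 : ℝ) < k := by linarith
    have e1 : ((k : ℝ) - 1) / k = ((2 * k - 1) - 1) / ((2 * k - 1) + 1) := by
      field_simp; ring_nf
    have e2 : (k : ℝ) / (k + 1) = ((2 * k + 1) - 1) / ((2 * k + 1) + 1) := by
      have : (2 * (k : ℝ) + 1 + 1) ≠ 0 := by positivity
      have : ((k : ℝ) + 1) ≠ 0 := by positivity
      field_simp; ring
    have hhalf : (1 : ℝ) / 2 ≤ (k - 1) / k := by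
      rw [div_le_div_iff₀ (by norm_num) hko]; linarith
    have hhalf2 : (1 : ℝ) / 2 < (2 * k - 1) / (2 * k + 1) := by
      rw [div_lt_div_iff₀ (by norm_num) (by linarith)]; linarith
    rcases he with rfl | rfl
    · simp only [if_true] at hy
      have hy2 := hhalf2.trans hy.1
      have := key (2 * k) (2 * k + 1) (by linarith) (by linarith) hy.1.le (e2 ▸ hy.2) hy2
      exact ⟨⟨fun h => (by cases h), fun h => (by linarith)⟩, Or.inl ⟨rfl, this⟩⟩
    · rw [if_neg (by norm_num)] at hy
      have hy2 := hhalf.trans_lt hy.1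
      have := key (2 * k - 1) (2 * k) (by linarith) (by linarith) (e1 ▸ hy.1.le) hy.2 hy2
      exact ⟨⟨fun h => (by cases h), fun h => (by linarith)⟩, Or.inr ⟨rfl, this⟩⟩

lemma h_mem_branch {d : Digit} (hd : d.Valid) {x : ℝ} (hx : x ∈ Ioo (0 : ℝ) 1) :
    h d x ∈ branch d := by
  obtain ⟨h0, h1⟩ := hx
  have ha := a_ge_one_real hd
  have ha2 := a_ge_two_real hd
  have he := valid_eps hd
  have hv := hd
  obtain ⟨k, ε, s⟩ := d
  simp only at ha ha2 he
  cases s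
  · simp only [branch, h]
    by_cases hk1 : k = 1
    · subst hk1
      have hε : ε = 1 := by
        rcases hv with ⟨h1, _⟩ | ⟨_, h1, _⟩
        · simp at h1
        · exact h1
      subst hε
      simp only [if_true]
      constructor
      · apply one_div_le_one_div_of_le <;> push_cast <;> linarith
      · apply one_div_le_one_div_of_le <;> push_cast <;> linarith
    · rw [if_neg hk1]
      rcases he with rfl | rfl
      · simp only [if_true]
        constructor
        · apply one_div_le_one_div_of_le <;> push_cast <;> linarith
        · apply one_div_lt_one_div_of_lt <;> push_cast <;> linarith
      · rw [if_neg (by norm_num)]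
        have hk := ha2 (Or.inr rfl)
        constructor
        · apply one_div_le_one_div_of_le <;> push_cast <;> linarith
        · apply one_div_lt_one_div_of_lt <;> push_cast <;> linarith
  · have hk := ha2 (Or.inl rfl)
    simp only [branch, h]
    rcases he with rfl | rfl
    · simp only [if_true]
      have hp : (0 : ℝ) < k * x + (k + 1) := by positivity
      constructor
      · rw [div_lt_div_iff₀ (by linarith) hp]; nlinarith
      · rw [div_le_div_iff₀ hp (by linarith)]; nlinarith
    · rw [if_neg (by norm_num), if_neg (by norm_num)]
      have hp : (0 : ℝ) < (k + 1) * x + k := by positivity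
      constructor
      · rw [div_lt_div_iff₀ (by linarith) hp]; nlinarith
      · rw [div_le_div_iff₀ hp (by linarith)]; nlinarith

lemma branch_unique {d d' : Digit} (hd : d.Valid) (hd' : d'.Valid) {x : ℝ}
    (hx : x ∈ Ioo (0 : ℝ) 1) (hb : h d x ∈ branch d') : d' = d := by
  obtain ⟨hs', hc'⟩ := branch_code hd' hb
  obtain ⟨hs, -⟩ := branch_code hd (h_mem_branch hd hx)
  rw [code_h hd hx] at hc'
  obtain ⟨t0, t1⟩ := inner_mem (s := d.s) hx
  have he := valid_eps hd
  have hss : d'.s = d.s := by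
    have hiff : d'.s = Par.e ↔ d.s = Par.e := hs'.trans hs.symm
    revert hiff
    cases d'.s <;> cases d.s <;> simp
  obtain ⟨k, ε, s⟩ := d
  obtain ⟨k', ε', s'⟩ := d'
  simp only at hss hc' he t0 t1
  subst hss
  generalize inner s' x = t at *
  rcases he with rfl | rfl <;> rcases hc' with ⟨rfl, h1, h2⟩ | ⟨rfl, h1, h2⟩ <;> push_cast at h1 h2
  · have a1 : (k' : ℝ) < k + 1 := by linarith
    have a2 : (k : ℝ) < k' + 1 := by linarith
    have : k' = k := by
      have b1 : k' < k + 1 := by exact_mod_cast a1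
      have b2 : k < k' + 1 := by exact_mod_cast a2
      omega
    rw [this]
  · exfalso
    have a1 : (k' : ℝ) < k + 1 := by linarith
    have a2 : (k : ℝ) < k' := by linarith
    have b1 : k' < k + 1 := by exact_mod_cast a1
    have b2 : k < k' := by exact_mod_cast a2
    omega
  · exfalso
    have a1 : (k' : ℝ) < k := by linarith
    have a2 : (k : ℝ) < k' + 1 := by linarith
    have b1 : k' < k := by exact_mod_cast a1
    have b2 : k < k' + 1 := by exact_mod_cast a2
    omega
  · have a1 : (k' : ℝ) < k + 1 := by linarith
    have a2 : (k : ℝ) < k' + 1 := by linarith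
    have : k' = k := by
      have b1 : k' < k + 1 := by exact_mod_cast a1
      have b2 : k < k' + 1 := by exact_mod_cast a2
      omega
    rw [this]

lemma digit_h {d : Digit} (hd : d.Valid) {x : ℝ} (hx : x ∈ Ioo (0 : ℝ) 1) : digit (h d x) = d := by
  have hex : ∃ d' : Digit, d'.Valid ∧ h d x ∈ branch d' := ⟨d, hd, h_mem_branch hd hx⟩
  rw [digit, dif_pos hex]
  exact branch_unique hd hex.choose_spec.1 hx hex.choose_spec.2

lemma T_rat (q : ℚ) : ∃ r : ℚ, T (q : ℝ) = r := by
  have hTe : ∀ q : ℚ, ∃ r : ℚ, Te (q : ℝ) = r := by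
    intro q
    refine ⟨|1 / q - 2 * (⌊(1 / (q : ℝ) + 1) / 2⌋ : ℚ)|, ?_⟩
    rw [Te]; push_cast; rfl
  have hi : ∀ q : ℚ, ∃ r : ℚ, iota (q : ℝ) = r := by
    intro q
    refine ⟨(1 - q) / (1 + q), ?_⟩
    rw [iota]; push_cast; rfl
  rw [T]
  split_ifs
  · exact ⟨0, by simp⟩
  · exact ⟨1, by simp⟩
  · exact hTe q
  · obtain ⟨r1, h1⟩ := hi q
    obtain ⟨r2, h2⟩ := hTe r1
    rw [h1, h2]
    exact hi r2

lemma h_rat (d : Digit) (q : ℚ) : ∃ r : ℚ, h d (q : ℝ) = r := by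
  obtain ⟨k, ε, s⟩ := d
  cases s
  · refine ⟨1 / (2 * (k : ℚ) + ε * q), ?_⟩
    simp [h]
  · by_cases he : ε = 1
    · refine ⟨(((k : ℚ) - 1) * q + k) / (k * q + (k + 1)), ?_⟩
      simp [h, he]
    · refine ⟨((k : ℚ) * q + (k - 1)) / ((k + 1) * q + k), ?_⟩
      simp [h, he]

lemma irrational_h {d : Digit} (hd : d.Valid) {x : ℝ} (hx : x ∈ Ioo (0 : ℝ) 1) :
    Irrational (h d x) ↔ Irrational x := by
  constructor
  · rintro hi ⟨q, rfl⟩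
    obtain ⟨r, hr⟩ := h_rat d q
    exact hi ⟨r, hr.symm⟩
  · rintro hi ⟨q, hq⟩
    obtain ⟨r, hr⟩ := T_rat q
    rw [hq, T_h hd hx] at hr
    exact hi ⟨r, hr.symm⟩

lemma code_inj {y z : ℝ} (hy : y ∈ Ioo (0 : ℝ) 1) (hz : z ∈ Ioo (0 : ℝ) 1)
    (hs : y ≤ 1 / 2 ↔ z ≤ 1 / 2) (hc : code y = code z) : y = z := by
  unfold code at hc
  by_cases h1 : y ≤ 1 / 2
  · rw [if_pos h1, if_pos (hs.1 h1)] at hc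
    simpa using hc
  · rw [if_neg h1, if_neg (fun h => h1 (hs.2 h))] at hc
    have : iota y = iota z := by simpa using hc
    rw [← iota_iota hy.1, ← iota_iota hz.1, this]

lemma exists_branch {y : ℝ} (hy : y ∈ Ioo (0 : ℝ) 1) (hi : Irrational y) :
    ∃ d : Digit, d.Valid ∧ ∃ t ∈ Ioo (0 : ℝ) 1, h d t = y := by
  have hirr : Irrational (code y) := by
    rintro ⟨q, hq⟩
    unfold code at hq
    split_ifs at hq
    · exact hi ⟨1 / q, by push_cast; rw [hq]; simp⟩
    · refine hi ⟨(1 - 1 / q) / (1 + 1 / q), ?_⟩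
      rw [← iota_iota hy.1]
      push_cast
      rw [hq, one_div_one_div]; rfl
  have hgt : 2 < code y ∧ (1 / 2 < y → 3 < code y) := by
    unfold code
    by_cases h1 : y ≤ 1 / 2
    · rw [if_pos h1]
      have : y < 1 / 2 := lt_of_le_of_ne h1 (fun h => hi ⟨1 / 2, by rw [h]; push_cast; rfl⟩)
      refine ⟨?_, fun h => by linarith⟩
      rw [lt_one_div (by norm_num) hy.1]; exact this
    · rw [if_neg h1, iota, one_div_div]
      have h2 : 0 < 1 - y := by linarith [hy.2]
      rw [lt_div_iff₀ h2, lt_div_iff₀ h2]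
      push Not at h1
      exact ⟨by linarith, fun _ => by linarith⟩
  set c := code y with hc
  set k := ⌊(c + 1) / 2⌋ with hk
  have hk1 : (k : ℝ) ≤ (c + 1) / 2 := Int.floor_le _
  have hk2 : (c + 1) / 2 < k + 1 := Int.lt_floor_add_one _
  have hne : ∀ z : ℤ, c ≠ z := fun z hz => hirr ⟨z, by rw [hz]; simp⟩
  have hne1 : c ≠ 2 * k := by have := hne (2 * k); push_cast at this; exact this
  have hne2 : c ≠ 2 * k - 1 := by have := hne (2 * k - 1); push_cast at this; exact this
  have hk1' : 2 * (k : ℝ) - 1 < c := lt_of_le_of_ne (by linarith) (Ne.symm hne2)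
  have hkone : (1 : ℤ) ≤ k := by
    rw [hk, Int.le_floor]; push_cast; linarith [hgt.1]
  have fin : ∀ ε : ℤ, (ε = 1 ∨ ε = -1) → ∀ t ∈ Ioo (0 : ℝ) 1, c = 2 * k + ε * t → 
      ∃ d : Digit, d.Valid ∧ ∃ t ∈ Ioo (0 : ℝ) 1, h d t = y := by
    intro ε hε t ht hct
    by_cases h1 : y ≤ 1 / 2
    · have hv : Digit.Valid ⟨k, ε, Par.e⟩ := by
        rcases hkone.eq_or_lt with h | h
        · right
          refine ⟨h.symm, ?_, rfl⟩
          rcases hε with hε | hε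
          · exact hε
          · exfalso
            rw [hε, ← h] at hct
            push_cast at hct
            linarith [hgt.1, ht.1]
        · left
          exact ⟨h, hε⟩
      refine ⟨_, hv, t, ht, ?_⟩
      have hp := h_pos_side hv ht
      refine code_inj hp.1 hy ⟨fun _ => h1, fun _ => hp.2.1 rfl⟩ ?_
      rw [code_h hv ht, ← hc, hct]; rfl
    · have hc3 := hgt.2 (by linarith)
      have hv : Digit.Valid ⟨k, ε, Par.o⟩ := by
        left
        refine ⟨?_, hε⟩
        change 2 ≤ k
        rw [hk, Int.le_floor]; push_cast; linarith
      have hti := iota_mem ht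
      refine ⟨_, hv, iota t, hti, ?_⟩
      have hp := h_pos_side hv hti
      refine code_inj hp.1 hy ⟨fun h => absurd h (not_le.2 (hp.2.2 rfl)), fun h => absurd h h1⟩ ?_
      rw [code_h hv hti, ← hc, hct]
      simp only [inner]
      rw [iota_iota ht.1]
  rcases lt_or_gt_of_ne hne1 with hlt | hgt'
  · exact fin (-1) (Or.inr rfl) (2 * k - c) ⟨by linarith, by linarith⟩ (by push_cast; ring)
  · exact fin 1 (Or.inl rfl) (c - 2 * k) ⟨by linarith, by linarith⟩ (by push_cast; ring)

/-! ### The surviving sets -/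

/-- All valid digits with `a ≤ m + 1`. -/
def Dg : ℕ → Finset Digit
  | 0 => {⟨1, 1, Par.e⟩}
  | m + 1 => insert ⟨(m : ℤ) + 2, 1, Par.e⟩ (insert ⟨(m : ℤ) + 2, -1, Par.e⟩
      (insert ⟨(m : ℤ) + 2, 1, Par.o⟩ (insert ⟨(m : ℤ) + 2, -1, Par.o⟩ (Dg m))))

lemma mem_Dg (m : ℕ) (d : Digit) : d ∈ Dg m ↔ d.Valid ∧ d.a ≤ (m : ℤ) + 1 := by
  induction m with
  | zero =>
    obtain ⟨k, ε, s⟩ := d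
    simp only [Dg, Finset.mem_singleton, Digit.mk.injEq, Digit.Valid]
    push_cast
    constructor
    · rintro ⟨rfl, rfl, rfl⟩; simp
    · rintro ⟨⟨h, _⟩ | h, h2⟩
      · omega
      · exact h
  | succ m ih =>
    simp only [Dg, Finset.mem_insert, ih]
    obtain ⟨k, ε, s⟩ := d
    simp only [Digit.mk.injEq, Digit.Valid]
    push_cast
    cases s <;> simp <;> omega

lemma sum_Dg_succ (m : ℕ) (f : Digit → ℝ) :
    ∑ d ∈ Dg (m + 1), f d = f ⟨(m : ℤ) + 2, 1, Par.e⟩ + (f ⟨(m : ℤ) + 2, -1, Par.e⟩ +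
      (f ⟨(m : ℤ) + 2, 1, Par.o⟩ + (f ⟨(m : ℤ) + 2, -1, Par.o⟩ + ∑ d ∈ Dg m, f d))) := by
  have hn : ∀ ε s, (⟨(m : ℤ) + 2, ε, s⟩ : Digit) ∉ Dg m := by
    intro ε s hh
    have := ((mem_Dg m _).1 hh).2
    simp only at this
    omega
  rw [Dg, Finset.sum_insert, Finset.sum_insert, Finset.sum_insert, Finset.sum_insert]
  all_goals simp [hn]

/-- Irrational points whose first `n` digits are at most `m + 1`. -/
def Sv (m n : ℕ) : Set ℝ := {x : ℝ | x ∈ Ioo (0 : ℝ) 1 ∧ Irrational x ∧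
  ∀ i : ℕ, 1 ≤ i → i ≤ n → a i x ≤ (m : ℤ) + 1}

lemma Sv_subset (m n : ℕ) : Sv m n ⊆ Ioo (0 : ℝ) 1 := fun _ hx => hx.1

lemma a_one_h {d : Digit} (hd : d.Valid) {x : ℝ} (hx : x ∈ Ioo (0 : ℝ) 1) : a 1 (h d x) = d.a := by
  simp [a, dig, digit_h hd hx]

lemma a_succ_h {d : Digit} (hd : d.Valid) {x : ℝ} (hx : x ∈ Ioo (0 : ℝ) 1) {i : ℕ} (hi : 1 ≤ i) :
    a (i + 1) (h d x) = a i x := by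
  obtain ⟨j, rfl⟩ : ∃ j, i = j + 1 := ⟨i - 1, by omega⟩
  simp [a, dig, T_h hd hx]

lemma Sv_succ (m n : ℕ) : Sv m (n + 1) = ⋃ d ∈ Dg m, h d '' Sv m n := by
  ext y
  simp only [mem_iUnion, mem_image, exists_prop, mem_Dg]
  constructor
  · rintro ⟨hy, hi, ha⟩
    obtain ⟨d, hd, t, ht, rfl⟩ := exists_branch hy hi
    refine ⟨d, ⟨hd, ?_⟩, t, ⟨ht, (irrational_h hd ht).1 hi, ?_⟩, rfl⟩
    · have := ha 1 le_rfl (by omega)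
      rwa [a_one_h hd ht] at this
    · intro i h1 h2
      have := ha (i + 1) (by omega) (by omega)
      rwa [a_succ_h hd ht h1] at this
  · rintro ⟨d, ⟨hd, hda⟩, t, ⟨ht, hti, hta⟩, rfl⟩
    refine ⟨(h_pos_side hd ht).1, (irrational_h hd ht).2 hti, ?_⟩
    intro i h1 h2
    rcases h1.eq_or_lt with rfl | h3
    · rwa [a_one_h hd ht]
    · obtain ⟨j, rfl⟩ : ∃ j, i = j + 1 := ⟨i - 1, by omega⟩
      rw [a_succ_h hd ht (by omega)]
      exact hta j (by omega) (by omega)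

lemma Sv_disjoint (m n : ℕ) : (Dg m : Set Digit).PairwiseDisjoint (fun d => h d '' Sv m n) := by
  intro d hd d' hd' hne
  rw [Function.onFun, Set.disjoint_left]
  rintro y ⟨t, ht, rfl⟩ ⟨t', ht', hy⟩
  apply hne
  have h1 := ((mem_Dg m d).1 hd).1
  have h2 := ((mem_Dg m d').1 hd').1
  rw [← digit_h h1 ht.1, ← digit_h h2 ht'.1, hy]

lemma Sv_zero (m : ℕ) : Sv m 0 = Ioo (0 : ℝ) 1 ∩ {x | Irrational x} := by
  ext x
  simp only [Sv, mem_ofPred_eq, mem_inter_iff]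
  constructor
  · rintro ⟨h1, h2, _⟩; exact ⟨h1, h2⟩
  · rintro ⟨h1, h2⟩; exact ⟨h1, h2, fun i h3 h4 => by omega⟩

/-! ### Mobius coefficients of the branches -/

/-- Coefficients of `h d x = (cA x + cB) / (cC x + cE)`. -/
noncomputable def cA (d : Digit) : ℝ := match d.s with
  | Par.e => 0
  | Par.o => if d.eps = 1 then (d.a : ℝ) - 1 else d.a

noncomputable def cB (d : Digit) : ℝ := match d.s with
  | Par.e => 1
  | Par.o => if d.eps = 1 then (d.a : ℝ) else d.a - 1

noncomputable def cC (d : Digit) : ℝ := match d.s with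
  | Par.e => d.eps
  | Par.o => if d.eps = 1 then (d.a : ℝ) else d.a + 1

noncomputable def cE (d : Digit) : ℝ := match d.s with
  | Par.e => 2 * d.a
  | Par.o => if d.eps = 1 then (d.a : ℝ) + 1 else d.a

noncomputable def num (d : Digit) (x : ℝ) : ℝ := cA d * x + cB d
noncomputable def den (d : Digit) (x : ℝ) : ℝ := cC d * x + cE d

lemma h_eq (d : Digit) (x : ℝ) : h d x = num d x / den d x := by
  obtain ⟨k, ε, s⟩ := d
  cases s
  · simp only [h, num, den, cA, cB, cC, cE]
    congr 1 <;> ring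
  · simp only [h, num, den, cA, cB, cC, cE]
    split_ifs <;> rfl

lemma valid_cases {P : Digit → Prop}
    (he : ∀ k : ℤ, 1 ≤ k → P ⟨k, 1, Par.e⟩) (he' : ∀ k : ℤ, 2 ≤ k → P ⟨k, -1, Par.e⟩)
    (ho : ∀ k : ℤ, 2 ≤ k → P ⟨k, 1, Par.o⟩) (ho' : ∀ k : ℤ, 2 ≤ k → P ⟨k, -1, Par.o⟩)
    (d : Digit) (hd : d.Valid) : P d := by
  obtain ⟨k, ε, s⟩ := d
  simp only [Digit.Valid] at hd
  rcases hd with ⟨hk, rfl | rfl⟩ | ⟨rfl, rfl, rfl⟩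
  · cases s
    · exact he k (by omega)
    · exact ho k hk
  · cases s
    · exact he' k hk
    · exact ho' k hk
  · exact he 1 le_rfl

lemma den_pos {d : Digit} (hd : d.Valid) {x : ℝ} (hx : x ∈ Ioo (0 : ℝ) 1) : 0 < den d x := by
  obtain ⟨h0, h1⟩ := hx
  refine valid_cases (P := fun d => 0 < den d x) ?_ ?_ ?_ ?_ d hd <;> intro k hk
  · have hk' : (1 : ℝ) ≤ k := by exact_mod_cast hk
    simp [den, cC, cE]; positivity
  · have hk' : (2 : ℝ) ≤ k := by exact_mod_cast hk
    simp [den, cC, cE]; linarith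
  · have hk' : (2 : ℝ) ≤ k := by exact_mod_cast hk
    simp [den, cC, cE]; positivity
  · have hk' : (2 : ℝ) ≤ k := by exact_mod_cast hk
    simp [den, cC, cE]; positivity

lemma det_abs {d : Digit} (hd : d.Valid) : |cA d * cE d - cB d * cC d| = 1 := by
  refine valid_cases (P := fun d => |cA d * cE d - cB d * cC d| = 1) ?_ ?_ ?_ ?_ d hd <;>
    intro k hk <;> simp [cA, cB, cC, cE]
  · rw [show ((k : ℝ) - 1) * (k + 1) - k * k = -1 by ring]; simp
  · rw [show (k : ℝ) * k - (k - 1) * (k + 1) = 1 by ring]; simp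

lemma num_pos {d : Digit} (hd : d.Valid) {x : ℝ} (hx : x ∈ Ioo (0 : ℝ) 1) : 0 < num d x := by
  have h1 := (h_pos_side hd hx).1.1
  rw [h_eq] at h1
  have := den_pos hd hx
  by_contra hc
  exact absurd h1 (not_lt.2 (div_nonpos_of_nonpos_of_nonneg (not_lt.1 hc) this.le))

lemma num_lt_den {d : Digit} (hd : d.Valid) {x : ℝ} (hx : x ∈ Ioo (0 : ℝ) 1) :
    num d x < den d x := by
  have h1 := (h_pos_side hd hx).1.2
  rwa [h_eq, div_lt_one (den_pos hd hx)] at h1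

lemma hasDerivAt_num (d : Digit) (x : ℝ) : HasDerivAt (num d) (cA d) x := by
  have := ((hasDerivAt_id x).const_mul (cA d)).add_const (cB d)
  rw [mul_one] at this
  exact this

lemma hasDerivAt_den (d : Digit) (x : ℝ) : HasDerivAt (den d) (cC d) x := by
  have := ((hasDerivAt_id x).const_mul (cC d)).add_const (cE d)
  rw [mul_one] at this
  exact this

lemma hasDerivAt_h {d : Digit} (hd : d.Valid) {x : ℝ} (hx : x ∈ Ioo (0 : ℝ) 1) :
    HasDerivAt (h d) ((cA d * cE d - cB d * cC d) / den d x ^ 2) x := by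
  have hh : h d = fun x => num d x / den d x := funext (h_eq d)
  rw [hh]
  have := (hasDerivAt_num d x).fun_div (hasDerivAt_den d x) (den_pos hd hx).ne'
  have e : cA d * cE d - cB d * cC d = cA d * den d x - num d x * cC d := by
    simp only [num, den]; ring
  rw [e]
  exact this

lemma measurableSet_Sv (m n : ℕ) : MeasurableSet (Sv m n) := by
  induction n with
  | zero =>
    rw [Sv_zero]
    refine measurableSet_Ioo.inter ?_
    have : {x : ℝ | Irrational x} = (Set.range ((↑) : ℚ → ℝ))ᶜ := rfl
    rw [this]
    exact (Set.countable_range _).measurableSet.compl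
  | succ n ih =>
    rw [Sv_succ]
    refine Finset.measurableSet_biUnion _ fun d hd => ?_
    have hv := ((mem_Dg m d).1 hd).1
    refine ih.image_of_continuousOn_injOn ?_ ((h_injOn hv).mono (Sv_subset m n))
    intro x hx
    exact (hasDerivAt_h hv (Sv_subset m n hx)).continuousAt.continuousWithinAt

/-! ### Normalised weights of the transfer operator -/

noncomputable def s3 : ℝ := Real.sqrt 3

lemma s3_sq : s3 * s3 = 3 := Real.mul_self_sqrt (by norm_num)

lemma s3_gt : 1.732 < s3 := by
  rw [s3]; apply Real.lt_sqrt_of_sq_lt; norm_num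

lemma s3_lt : s3 < 1.7321 := by
  rw [s3, Real.sqrt_lt' (by norm_num)]; norm_num

noncomputable def uu (x : ℝ) : ℝ := (1 - (2 - s3) * x) * (1 + s3 * x)
noncomputable def uD (x : ℝ) : ℝ := (2 * s3 - 2) - 2 * (2 * s3 - 3) * x

lemma uu_eq (x : ℝ) : uu x = 1 + (2 * s3 - 2) * x - (2 * s3 - 3) * x ^ 2 := by
  unfold uu
  linear_combination (x ^ 2) * s3_sq

lemma uu_pos {x : ℝ} (hx : x ∈ Ioo (0 : ℝ) 1) : 0 < uu x := by
  obtain ⟨h0, h1⟩ := hx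
  have := s3_gt
  have := s3_lt
  unfold uu
  apply mul_pos <;> nlinarith

lemma hasDerivAt_uu (x : ℝ) : HasDerivAt uu (uD x) x := by
  have hf : uu = fun x => 1 + (2 * s3 - 2) * x - (2 * s3 - 3) * x ^ 2 := funext uu_eq
  rw [hf]
  have := ((((hasDerivAt_id x).const_mul (2 * s3 - 2)).const_add 1).fun_sub
    (((hasDerivAt_id x).fun_pow 2).const_mul (2 * s3 - 3)))
  simp only [id] at this
  convert! this using 1
  unfold uD
  push_cast
  ring

noncomputable def Pp (d : Digit) (x : ℝ) : ℝ := den d x - (2 - s3) * num d x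
noncomputable def Qq (d : Digit) (x : ℝ) : ℝ := den d x + s3 * num d x

lemma Pp_pos {d : Digit} (hd : d.Valid) {x : ℝ} (hx : x ∈ Ioo (0 : ℝ) 1) : 0 < Pp d x := by
  have h1 := num_pos hd hx
  have h2 := num_lt_den hd hx
  have := s3_gt
  unfold Pp
  nlinarith

lemma Qq_pos {d : Digit} (hd : d.Valid) {x : ℝ} (hx : x ∈ Ioo (0 : ℝ) 1) : 0 < Qq d x := by
  have h1 := num_pos hd hx
  have h2 := den_pos hd hx
  have := s3_gt
  unfold Qq
  nlinarith

/-- The normalised weight. -/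
noncomputable def gw (d : Digit) (x : ℝ) : ℝ := uu x / (Pp d x * Qq d x)

lemma gw_pos {d : Digit} (hd : d.Valid) {x : ℝ} (hx : x ∈ Ioo (0 : ℝ) 1) : 0 < gw d x :=
  div_pos (uu_pos hx) (mul_pos (Pp_pos hd hx) (Qq_pos hd hx))

/-- Logarithmic derivative of the weight. -/
noncomputable def Rr (d : Digit) (x : ℝ) : ℝ :=
  uD x / uu x - (cC d - (2 - s3) * cA d) / Pp d x - (cC d + s3 * cA d) / Qq d x

lemma hasDerivAt_gw {d : Digit} (hd : d.Valid) {x : ℝ} (hx : x ∈ Ioo (0 : ℝ) 1) :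
    HasDerivAt (gw d) (gw d x * Rr d x) x := by
  have hP := Pp_pos hd hx
  have hQ := Qq_pos hd hx
  have hu := uu_pos hx
  have dP : HasDerivAt (Pp d) (cC d - (2 - s3) * cA d) x :=
    (hasDerivAt_den d x).fun_sub ((hasDerivAt_num d x).const_mul (2 - s3))
  have dQ : HasDerivAt (Qq d) (cC d + s3 * cA d) x :=
    (hasDerivAt_den d x).fun_add ((hasDerivAt_num d x).const_mul s3)
  have := (hasDerivAt_uu x).fun_div (dP.fun_mul dQ) (mul_pos hP hQ).ne'
  convert! this using 1
  unfold gw Rr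
  field_simp
  ring

noncomputable def LL : ℝ := Real.log (2 + Real.sqrt 3)

lemma LL_pos : 0 < LL := by
  apply Real.log_pos
  have := Real.sqrt_nonneg 3
  linarith

lemma fdens_eq (x : ℝ) : fdens x = 2 / (LL * uu x) := by
  unfold fdens LL uu s3
  rw [mul_assoc]

lemma fdens_h {d : Digit} (hd : d.Valid) {x : ℝ} (hx : x ∈ Ioo (0 : ℝ) 1) :
    |(cA d * cE d - cB d * cC d) / den d x ^ 2| * fdens (h d x) = gw d x * fdens x := by
  have hd0 := den_pos hd hx
  have hP := Pp_pos hd hx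
  have hQ := Qq_pos hd hx
  have hu := uu_pos hx
  have hL := LL_pos
  rw [abs_div, det_abs hd, abs_of_pos (by positivity), fdens_eq, fdens_eq, gw, h_eq]
  have e : uu (num d x / den d x) = Pp d x * Qq d x / den d x ^ 2 := by
    unfold uu Pp Qq
    field_simp
  rw [e]
  field_simp

/-! ### The contraction estimate -/

lemma r_bounds {x : ℝ} (hx : x ∈ Ioo (0 : ℝ) 1) : 0.25 ≤ uD x / uu x ∧ uD x / uu x ≤ 1.465 := by
  have hu := uu_pos hx
  obtain ⟨h0, h1⟩ := hx
  have := s3_gt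
  have := s3_lt
  rw [le_div_iff₀ hu, div_le_iff₀ hu, uu_eq, uD]
  have hx2 : 0 < x * (1 - x) := mul_pos h0 (by linarith)
  have a1 := mul_pos h0 (sub_pos.2 s3_gt)
  have a2 := mul_pos h0 (sub_pos.2 s3_lt)
  have a3 := mul_pos (mul_pos h0 h0) (sub_pos.2 s3_gt)
  have a4 := mul_pos (mul_pos h0 h0) (sub_pos.2 s3_lt)
  constructor <;> nlinarith

set_option maxHeartbeats 1000000 in
lemma contraction {d : Digit} (hd : d.Valid) {x : ℝ} (hx : x ∈ Ioo (0 : ℝ) 1) :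
    1 / den d x ^ 2 + |Rr d x| * |h d x - 1 / 2| ≤ 99 / 100 := by
  have s1 := s3_gt
  have s2 := s3_lt
  obtain ⟨hr1, hr2⟩ := r_bounds hx
  have hP := Pp_pos hd hx
  have hQ := Qq_pos hd hx
  have hD := den_pos hd hx
  have hside := h_pos_side hd hx
  have hheq := h_eq d x
  obtain ⟨h0, h1⟩ := hx
  unfold Rr
  generalize uD x / uu x = r at *
  revert hP hQ hD hside hheq
  refine valid_cases (P := fun d => 0 < Pp d x → 0 < Qq d x → 0 < den d x →
    (h d x ∈ Ioo (0 : ℝ) 1 ∧ (d.s = Par.e → h d x ≤ 1 / 2) ∧ (d.s = Par.o → 1 / 2 < h d x)) →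
    h d x = num d x / den d x → 
    1 / den d x ^ 2 + |r - (cC d - (2 - s3) * cA d) / Pp d x - (cC d + s3 * cA d) / Qq d x|
      * |h d x - 1 / 2| ≤ 99 / 100) ?_ ?_ ?_ ?_ d hd <;> intro k hk hP hQ hD hside hheq
  · have hk' : (1 : ℝ) ≤ k := by exact_mod_cast hk
    have hz := hside.2.1 rfl
    have hz0 := hside.1.1
    simp only [cA, cC, Pp, Qq, den, num, cB, cE] at *
    push_cast at *
    have b1 : 1 / (1 * x + 2 * k) ^ 2 ≤ 1 / (4 : ℝ) := by
      apply one_div_le_one_div_of_le (by norm_num); nlinarith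
    have b2 : 0 < (1 - (2 - s3) * 0) / (1 * x + 2 * k - (2 - s3) * (0 * x + 1)) :=
      div_pos (by linarith) hP
    have b3 : 0 < (1 + s3 * 0) / (1 * x + 2 * k + s3 * (0 * x + 1)) :=
      div_pos (by linarith) hQ
    have b4 : (1 - (2 - s3) * 0) / (1 * x + 2 * k - (2 - s3) * (0 * x + 1)) ≤ 1 := by
      rw [div_le_one hP]; nlinarith
    have b5 : (1 + s3 * 0) / (1 * x + 2 * k + s3 * (0 * x + 1)) ≤ 0.5 := by
      rw [div_le_iff₀ hQ]; nlinarith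
    have b6 : |r - (1 - (2 - s3) * 0) / (1 * x + 2 * k - (2 - s3) * (0 * x + 1))
      - (1 + s3 * 0) / (1 * x + 2 * k + s3 * (0 * x + 1))| ≤ 1.465 := by
      rw [abs_le]; constructor <;> linarith
    have b7 : |h ⟨k, 1, Par.e⟩ x - 1 / 2| ≤ 1 / 2 := by
      rw [abs_le]; constructor <;> linarith
    have := mul_le_mul b6 b7 (abs_nonneg _) (by norm_num)
    linarith
  · have hk' : (2 : ℝ) ≤ k := by exact_mod_cast hk
    have hz := hside.2.1 rfl
    have hz0 := hside.1.1
    simp only [cA, cC, Pp, Qq, den, num, cB, cE] at *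
    push_cast at *
    rw [hheq] at *
    have ez : -1 * x + 2 * (k : ℝ) = 2 * k - x := by ring
    have z3 : (3 : ℝ) ≤ 2 * k - x := by linarith
    simp only [ez, zero_mul, zero_add, mul_zero, sub_zero, add_zero, mul_one] at *
    generalize 2 * (k : ℝ) - x = z at *
    have e1 : 1 / z ^ 2 = (1 / z) ^ 2 := by rw [div_pow, one_pow]
    have b2 : 1 / (z - (2 - s3)) ≤ 1.1 * (1 / z) := by
      rw [mul_one_div, div_le_div_iff₀ hP (by linarith)]; nlinarith
    have b3 : 1 / (z + s3) ≤ 1 / z := one_div_le_one_div_of_le (by linarith) (by linarith)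
    have b4 : 0 < 1 / (z - (2 - s3)) := by positivity
    have b5 : 0 < 1 / (z + s3) := by positivity
    rw [e1]
    rw [neg_div, neg_div]
    generalize 1 / (z - (2 - s3)) = A1 at *
    generalize 1 / (z + s3) = A2 at *
    have ht := hside.2.1 trivial
    have ht0 := hside.1.1
    generalize 1 / z = t at *
    rw [abs_of_nonneg (by linarith : 0 ≤ r - -A1 - -A2), abs_of_nonpos (by linarith : t - 1 / 2 ≤ 0)]
    have : (r - -A1 - -A2) * -(t - 1 / 2) ≤ (1.465 + 2.1 * t) * -(t - 1 / 2) :=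
      mul_le_mul_of_nonneg_right (by linarith) (by linarith)
    nlinarith
  · have hk' : (2 : ℝ) ≤ k := by exact_mod_cast hk
    have hz := hside.2.2 rfl
    have hz0 := hside.1.2
    simp only [cA, cC, Pp, Qq, den, num, cB, cE, if_true] at *
    have b1 : 1 / (k * x + (k + 1)) ^ 2 ≤ 1 / (9 : ℝ) := by
      apply one_div_le_one_div_of_le (by norm_num)
      have : (3 : ℝ) ≤ k * x + (k + 1) := by nlinarith
      nlinarith
    have b2 : 0 ≤ (k - (2 - s3) * (k - 1)) / (k * x + (k + 1) - (2 - s3) * ((k - 1) * x + k)) :=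
      div_nonneg (by nlinarith) hP.le
    have b3 : 0 ≤ (k + s3 * (k - 1)) / (k * x + (k + 1) + s3 * ((k - 1) * x + k)) :=
      div_nonneg (by nlinarith) hQ.le
    have b4 : (k - (2 - s3) * (k - 1)) / (k * x + (k + 1) - (2 - s3) * ((k - 1) * x + k)) ≤ 1 := by
      rw [div_le_one hP]
      have : 0 ≤ (k - (2 - s3) * (k - 1)) * x := mul_nonneg (by nlinarith) h0.le
      nlinarith
    have b5 : (k + s3 * (k - 1)) / (k * x + (k + 1) + s3 * ((k - 1) * x + k)) ≤ 1 := by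
      rw [div_le_one hQ]
      have : 0 ≤ (k + s3 * (k - 1)) * x := mul_nonneg (by nlinarith) h0.le
      nlinarith
    have b6 : |r - (k - (2 - s3) * (k - 1)) / (k * x + (k + 1) - (2 - s3) * ((k - 1) * x + k))
      - (k + s3 * (k - 1)) / (k * x + (k + 1) + s3 * ((k - 1) * x + k))| ≤ 1.75 := by
      rw [abs_le]; constructor <;> linarith
    have b7 : |h ⟨k, 1, Par.o⟩ x - 1 / 2| ≤ 1 / 2 := by
      rw [abs_le]; constructor <;> linarith
    have := mul_le_mul b6 b7 (abs_nonneg _) (by norm_num)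
    linarith
  · have hk' : (2 : ℝ) ≤ k := by exact_mod_cast hk
    have hz := hside.2.2 rfl
    have hz0 := hside.1.2
    simp only [cA, cC, Pp, Qq, den, num, cB, cE] at *
    simp only [show ¬ ((-1 : ℤ) = 1) by norm_num, if_false] at *
    have hkp : (0 : ℝ) < k := by linarith
    have b1 : 1 / (((k : ℝ) + 1) * x + k) ^ 2 ≤ (1 / k) ^ 2 := by
      rw [div_pow, one_pow]
      apply one_div_le_one_div_of_le (by positivity)
      have : (k : ℝ) ≤ (k + 1) * x + k := by nlinarith
      exact pow_le_pow_left₀ hkp.le this 2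
    have b2 : 0 ≤ (k + 1 - (2 - s3) * k) / ((k + 1) * x + k - (2 - s3) * (k * x + (k - 1))) :=
      div_nonneg (by nlinarith) hP.le
    have b3 : 0 ≤ (k + 1 + s3 * k) / ((k + 1) * x + k + s3 * (k * x + (k - 1))) :=
      div_nonneg (by nlinarith) hQ.le
    have b4 : (k + 1 - (2 - s3) * k) / ((k + 1) * x + k - (2 - s3) * (k * x + (k - 1)))
        ≤ 1 + 1 / k := by
      rw [div_le_iff₀ hP, show (1 : ℝ) + 1 / k = (k + 1) / k by field_simp, div_mul_eq_mul_div,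
        le_div_iff₀ hkp]
      have : 0 ≤ (k + 1 - (2 - s3) * k) * x * (k + 1) :=
        mul_nonneg (mul_nonneg (by nlinarith) h0.le) (by linarith)
      nlinarith
    have b5 : (k + 1 + s3 * k) / ((k + 1) * x + k + s3 * (k * x + (k - 1))) ≤ 1 + 1.5 * (1 / k) := by
      rw [div_le_iff₀ hQ, show (1 : ℝ) + 1.5 * (1 / k) = (k + 1.5) / k by field_simp,
        div_mul_eq_mul_div, le_div_iff₀ hkp]
      have : 0 ≤ (k + 1 + s3 * k) * x * (k + 1.5) :=
        mul_nonneg (mul_nonneg (by nlinarith) h0.le) (by linarith)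
      nlinarith
    have b6 : |r - (k + 1 - (2 - s3) * k) / ((k + 1) * x + k - (2 - s3) * (k * x + (k - 1)))
      - (k + 1 + s3 * k) / ((k + 1) * x + k + s3 * (k * x + (k - 1)))| ≤ 1.75 + 2.5 * (1 / k) := by
      have : 0 < 1 / (k : ℝ) := by positivity
      rw [abs_le]; constructor <;> linarith
    have b7 : |h ⟨k, -1, Par.o⟩ x - 1 / 2| ≤ 1 / 2 - 0.8 * (1 / k) := by
      rw [abs_of_pos (by linarith), hheq]
      have e1 : (k * x + (k - 1)) / ((k + 1) * x + k) ≤ 1 - 2 / (2 * k + 1 : ℝ) := by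
        rw [div_le_iff₀ hD, one_sub_div (by positivity), div_mul_eq_mul_div,
          le_div_iff₀ (by positivity)]
        linarith
      have e2 : 0.8 * (1 / (k : ℝ)) ≤ 2 / (2 * k + 1) := by
        rw [mul_one_div, div_le_div_iff₀ hkp (by positivity)]; linarith
      linarith
    have := mul_le_mul b6 b7 (abs_nonneg _) (by positivity)
    have ht0 : 0 < 1 / (k : ℝ) := by positivity
    generalize 1 / (k : ℝ) = t at *
    nlinarith

/-! ### Telescoping: the sum of the weights -/

noncomputable def B1 (M x : ℝ) : ℝ := M * (1 + x) + (s3 + 1) / 2 + x * ((s3 - 1) / 2)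
noncomputable def B2 (M x : ℝ) : ℝ := M * (1 + x) + (s3 - 1) / 2 + x * ((s3 + 1) / 2)

noncomputable def tailsum (M x : ℝ) : ℝ :=
  1 / (2 * M + s3 + x) + 1 / (2 * M + s3 - x) + 1 / ((1 + x) * B1 M x) + 1 / ((1 + x) * B2 M x)

lemma B1_pos {M x : ℝ} (hM : 1 ≤ M) (hx : x ∈ Ioo (0 : ℝ) 1) : 0 < B1 M x := by
  obtain ⟨h0, h1⟩ := hx
  have := s3_gt
  unfold B1
  have : 0 < (s3 - 1) / 2 := by linarith
  positivity

lemma B2_pos {M x : ℝ} (hM : 1 ≤ M) (hx : x ∈ Ioo (0 : ℝ) 1) : 0 < B2 M x := by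
  obtain ⟨h0, h1⟩ := hx
  have := s3_gt
  unfold B2
  have : 0 < (s3 - 1) / 2 := by linarith
  positivity

lemma one_div_sub_aux {p q : ℝ} (hp : p ≠ 0) (hq : q ≠ 0) :
    1 / p - 1 / q = (q - p) / (p * q) := by
  field_simp

lemma gw_e {k : ℤ} {ε : ℤ} (hv : Digit.Valid ⟨k, ε, Par.e⟩) {x : ℝ} (hx : x ∈ Ioo (0 : ℝ) 1)
    (h1 : 2 * ((k : ℝ) - 1) + s3 + ε * x ≠ 0) (h2 : 2 * (k : ℝ) + s3 + ε * x ≠ 0) :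
    gw ⟨k, ε, Par.e⟩ x = uu x / 2 * (1 / (2 * ((k : ℝ) - 1) + s3 + ε * x)
      - 1 / (2 * (k : ℝ) + s3 + ε * x)) := by
  have e1 : Pp ⟨k, ε, Par.e⟩ x = 2 * ((k : ℝ) - 1) + s3 + ε * x := by
    simp only [Pp, den, num, cA, cB, cC, cE]; ring
  have e2 : Qq ⟨k, ε, Par.e⟩ x = 2 * (k : ℝ) + s3 + ε * x := by
    simp only [Qq, den, num, cA, cB, cC, cE]; ring
  rw [gw, e1, e2, one_div_sub_aux h1 h2]
  field_simp
  ring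

lemma gw_o1 {k : ℤ} (hk : 2 ≤ k) {x : ℝ} (hx : x ∈ Ioo (0 : ℝ) 1) :
    gw ⟨k, 1, Par.o⟩ x = uu x / 2 * (1 / ((1 + x) * B1 (k - 1) x) - 1 / ((1 + x) * B1 k x)) := by
  have hk' : (2 : ℝ) ≤ k := by exact_mod_cast hk
  have p1 := B1_pos (M := (k : ℝ) - 1) (by linarith) hx
  have p2 := B1_pos (M := (k : ℝ)) (by linarith) hx
  have e1 : Pp ⟨k, 1, Par.o⟩ x = (s3 - 1) * B1 k x := by
    simp only [Pp, den, num, cA, cB, cC, cE, B1, if_true]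
    linear_combination (-(1 / 2) - (1 / 2) * x) * s3_sq
  have e2 : Qq ⟨k, 1, Par.o⟩ x = (s3 + 1) * B1 (k - 1) x := by
    simp only [Qq, den, num, cA, cB, cC, cE, B1, if_true]
    linear_combination (-(1 / 2) - (1 / 2) * x) * s3_sq
  have e3 : Pp ⟨k, 1, Par.o⟩ x * Qq ⟨k, 1, Par.o⟩ x = 2 * (B1 k x * B1 (k - 1) x) := by
    rw [e1, e2]; linear_combination (B1 k x * B1 (k - 1) x) * s3_sq
  have e4 : B1 k x = B1 (k - 1) x + (1 + x) := by unfold B1; ring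
  have hx1 : 0 < 1 + x := by linarith [hx.1]
  rw [gw, e3, one_div_sub_aux (by positivity) (by positivity)]
  rw [show (1 + x) * B1 k x - (1 + x) * B1 (k - 1) x = (1 + x) * (1 + x) by rw [e4]; ring]
  field_simp

lemma gw_o2 {k : ℤ} (hk : 2 ≤ k) {x : ℝ} (hx : x ∈ Ioo (0 : ℝ) 1) :
    gw ⟨k, -1, Par.o⟩ x = uu x / 2 * (1 / ((1 + x) * B2 (k - 1) x) - 1 / ((1 + x) * B2 k x)) := by
  have hk' : (2 : ℝ) ≤ k := by exact_mod_cast hk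
  have p1 := B2_pos (M := (k : ℝ) - 1) (by linarith) hx
  have p2 := B2_pos (M := (k : ℝ)) (by linarith) hx
  have hne : ¬ ((-1 : ℤ) = 1) := by norm_num
  have e1 : Pp ⟨k, -1, Par.o⟩ x = (s3 - 1) * B2 k x := by
    simp only [Pp, den, num, cA, cB, cC, cE, B2, hne, if_false]
    linear_combination (-(1 / 2) - (1 / 2) * x) * s3_sq
  have e2 : Qq ⟨k, -1, Par.o⟩ x = (s3 + 1) * B2 (k - 1) x := by
    simp only [Qq, den, num, cA, cB, cC, cE, B2, hne, if_false]
    linear_combination (-(1 / 2) - (1 / 2) * x) * s3_sq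
  have e3 : Pp ⟨k, -1, Par.o⟩ x * Qq ⟨k, -1, Par.o⟩ x = 2 * (B2 k x * B2 (k - 1) x) := by
    rw [e1, e2]; linear_combination (B2 k x * B2 (k - 1) x) * s3_sq
  have e4 : B2 k x = B2 (k - 1) x + (1 + x) := by unfold B2; ring
  have hx1 : 0 < 1 + x := by linarith [hx.1]
  rw [gw, e3, one_div_sub_aux (by positivity) (by positivity)]
  rw [show (1 + x) * B2 k x - (1 + x) * B2 (k - 1) x = (1 + x) * (1 + x) by rw [e4]; ring]
  field_simp

/-- Missing mass at level `m`. -/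
noncomputable def epsf (m : ℕ) (x : ℝ) : ℝ := uu x / 2 * tailsum ((m : ℝ) + 1) x

lemma sum_gw (m : ℕ) {x : ℝ} (hx : x ∈ Ioo (0 : ℝ) 1) :
    ∑ d ∈ Dg m, gw d x = 1 - epsf m x := by
  have s1 := s3_gt
  have s2 := s3_lt
  have hx' := hx
  obtain ⟨h0, h1⟩ := hx'
  induction m with
  | zero =>
    simp only [Dg, Finset.sum_singleton, epsf, tailsum]
    rw [gw_e (Or.inr ⟨rfl, rfl, rfl⟩) hx (by push_cast; positivity) (by push_cast; positivity)]
    have e1 : B1 1 x = (s3 + 1) / 2 * (s3 + x) := by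
      unfold B1; linear_combination (-(1 / 2)) * s3_sq
    have e2 : B2 1 x = (s3 + 1) / 2 * (1 + s3 * x) := by
      unfold B2; linear_combination (-(1 / 2) * x) * s3_sq
    have e3 : 2 + s3 - x = (2 + s3) * (1 - (2 - s3) * x) := by
      linear_combination (-x) * s3_sq
    have n1 : 0 < 1 - (2 - s3) * x := by nlinarith
    have n2 : 0 < 1 + s3 * x := by positivity
    have n3 : 0 < s3 + x := by positivity
    have n4 : 0 < 2 + s3 + x := by positivity
    have n5 : 0 < 1 + x := by positivity
    have key : 1 / (s3 + x) + 1 / ((2 + s3) * (1 - (2 - s3) * x))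
        + 1 / ((1 + x) * ((s3 + 1) / 2 * (s3 + x))) + 1 / ((1 + x) * ((s3 + 1) / 2 * (1 + s3 * x)))
        = 2 / uu x := by
      have k1 : 1 / ((1 + x) * ((s3 + 1) / 2 * (s3 + x)))
          + 1 / ((1 + x) * ((s3 + 1) / 2 * (1 + s3 * x))) = 2 / ((s3 + x) * (1 + s3 * x)) := by
        field_simp; ring
      have k2 : 1 / (s3 + x) + 2 / ((s3 + x) * (1 + s3 * x)) = s3 / (1 + s3 * x) := by
        field_simp
        linear_combination (-1 : ℝ) * s3_sq
      have k3 : 1 / ((2 + s3) * (1 - (2 - s3) * x)) = (2 - s3) / (1 - (2 - s3) * x) := by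
        rw [div_eq_div_iff (by positivity) (by positivity)]
        linear_combination (1 - (2 - s3) * x) * s3_sq
      have k4 : s3 / (1 + s3 * x) + (2 - s3) / (1 - (2 - s3) * x) = 2 / uu x := by
        rw [uu, div_add_div _ _ n2.ne' n1.ne', div_eq_div_iff (mul_pos n2 n1).ne' (mul_pos n1 n2).ne']
        ring
      linarith
    have hu := uu_pos hx
    have : uu x / 2 * (2 / uu x) = 1 := by field_simp
    push_cast
    simp only [zero_add, mul_one, sub_self, mul_zero, one_mul]
    rw [e1, e2, e3]
    rw [← key] at this
    linear_combination this
  | succ m ih =>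
    rw [sum_Dg_succ, ih]
    have hm : (0 : ℝ) ≤ m := Nat.cast_nonneg m
    rw [gw_e (Or.inl ⟨by simp, Or.inl rfl⟩) hx, gw_e (Or.inl ⟨by simp, Or.inr rfl⟩) hx,
      gw_o1 (by omega) hx, gw_o2 (by omega) hx]
    · simp only [epsf, tailsum]
      push_cast
      have e : ((m : ℝ) + 2 - 1) = m + 1 := by ring
      have e' : ((m : ℝ) + 1 + 1) = m + 2 := by ring
      have e'' : ∀ z : ℝ, -1 * z = - z := fun z => by ring
      simp only [e, e', one_mul, e'', ← sub_eq_add_neg]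
      ring
    all_goals (push_cast; apply ne_of_gt; linarith)

/-! ### Estimates for the missing mass -/

lemma quot_deriv {u l : ℝ → ℝ} {u' l' x M : ℝ} (hu : HasDerivAt u u' x) (hl : HasDerivAt l l' x)
    (hM : 0 < M) (hlM : M ≤ l x) (hll : |l'| ≤ 4 * l x) (hu3 : |u x| ≤ 3) (hu' : |u'| ≤ 3) :
    ∃ D, HasDerivAt (fun x => u x * (1 / l x)) D x ∧ |D| ≤ 15 / M := by
  have hl0 : 0 < l x := hM.trans_le hlM
  refine ⟨_, (hu.fun_mul ((hasDerivAt_const x (1 : ℝ)).fun_div hl hl0.ne')), ?_⟩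
  rw [zero_mul, zero_sub, one_mul]
  have e : u' * (1 / l x) + u x * (-l' / l x ^ 2) = (u' - u x * (l' / l x)) / l x := by
    field_simp
    ring
  rw [e, abs_div, abs_of_pos hl0]
  have h1 : |l' / l x| ≤ 4 := by
    rw [abs_div, abs_of_pos hl0, div_le_iff₀ hl0]; exact hll
  have h2 : |u' - u x * (l' / l x)| ≤ 15 := by
    calc _ ≤ |u'| + |u x * (l' / l x)| := abs_sub _ _
      _ ≤ 3 + 3 * 4 := by
        rw [abs_mul]
        exact add_le_add hu' (mul_le_mul hu3 h1 (abs_nonneg _) (by norm_num))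
      _ = 15 := by norm_num
  exact div_le_div₀ (by norm_num) h2 hM hlM

lemma epsf_deriv (m : ℕ) {x : ℝ} (hx : x ∈ Ioo (0 : ℝ) 1) :
    ∃ D, HasDerivAt (epsf m) D x ∧ |D| ≤ 30 / ((m : ℝ) + 1) := by
  have s1 := s3_gt
  have s2 := s3_lt
  have hm : (0 : ℝ) ≤ m := Nat.cast_nonneg m
  set M : ℝ := (m : ℝ) + 1 with hMdef
  have hM : 1 ≤ M := by linarith
  have p1 := B1_pos hM hx
  have p2 := B2_pos hM hx
  have hu0 := uu_pos hx
  have hu := hasDerivAt_uu x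
  obtain ⟨h0, h1⟩ := hx
  have hu3 : |uu x| ≤ 3 := by
    rw [abs_of_pos hu0, uu_eq]; nlinarith
  have hu' : |uD x| ≤ 3 := by
    rw [abs_le, uD]; constructor <;> nlinarith
  have l1 : HasDerivAt (fun x => 2 * M + s3 + x) 1 x := (hasDerivAt_id x).const_add _
  have l2 : HasDerivAt (fun x => 2 * M + s3 - x) (-1) x := (hasDerivAt_id x).const_sub _
  have l0 : HasDerivAt (fun x : ℝ => 1 + x) 1 x := (hasDerivAt_id x).const_add _
  have lB1 : HasDerivAt (B1 M) (M * 1 + 1 * ((s3 - 1) / 2)) x :=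
    ((l0.const_mul M).add_const _).fun_add ((hasDerivAt_id x).mul_const _)
  have lB2 : HasDerivAt (B2 M) (M * 1 + 1 * ((s3 + 1) / 2)) x :=
    ((l0.const_mul M).add_const _).fun_add ((hasDerivAt_id x).mul_const _)
  have l3 := l0.fun_mul lB1
  have l4 := l0.fun_mul lB2
  have q1 : 0 < 1 * B1 M x + (1 + x) * (M * 1 + 1 * ((s3 - 1) / 2)) := by
    have : 0 < (s3 - 1) / 2 := by linarith
    positivity
  have q2 : 0 < 1 * B2 M x + (1 + x) * (M * 1 + 1 * ((s3 + 1) / 2)) := by positivity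
  have hMx : 0 < M * x := by positivity
  have hMxx : 0 < M * x * x := by positivity
  obtain ⟨D1, d1, b1⟩ := quot_deriv hu l1 (M := M) (by linarith) (by linarith)
    (by rw [abs_one]; linarith) hu3 hu'
  obtain ⟨D2, d2, b2⟩ := quot_deriv hu l2 (M := M) (by linarith) (by linarith)
    (by rw [abs_neg, abs_one]; linarith) hu3 hu'
  obtain ⟨D3, d3, b3⟩ := quot_deriv hu l3 (M := M) (by linarith) (by unfold B1; nlinarith)
    (by rw [abs_of_pos q1]; unfold B1; nlinarith) hu3 hu'
  obtain ⟨D4, d4, b4⟩ := quot_deriv hu l4 (M := M) (by linarith) (by unfold B2; nlinarith)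
    (by rw [abs_of_pos q2]; unfold B2; nlinarith) hu3 hu'
  refine ⟨1 / 2 * (D1 + D2 + D3 + D4), ?_, ?_⟩
  · have := (((d1.fun_add d2).fun_add d3).fun_add d4).const_mul (1 / 2 : ℝ)
    refine this.congr_of_eventuallyEq (Eventually.of_forall fun z => ?_)
    simp only [epsf, tailsum]
    ring
  · rw [abs_mul]
    have := abs_add_le (D1 + D2 + D3) D4
    have := abs_add_le (D1 + D2) D3
    have := abs_add_le D1 D2
    rw [abs_of_pos (by norm_num : (0 : ℝ) < 1 / 2)]
    have : 30 / M = 2 * (15 / M) := by ring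
    linarith

lemma tailsum_bounds {M x : ℝ} (hM : 1 ≤ M) (hx : x ∈ Ioo (0 : ℝ) 1) :
    1 / (M + 2) + 2 / (M + 2) * (1 / (1 + x) ^ 2) ≤ tailsum M x ∧
    tailsum M x ≤ 1 / M + 2 / M * (1 / (1 + x) ^ 2) := by
  have s1 := s3_gt
  have s2 := s3_lt
  have p1 := B1_pos hM hx
  have p2 := B2_pos hM hx
  obtain ⟨h0, h1⟩ := hx
  have hMx : 0 < M * x := by positivity
  have hx1 : 0 < 1 + x := by positivity
  have c1 : M * (1 + x) ≤ B1 M x := by unfold B1; nlinarith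
  have c2 : B1 M x ≤ (M + 2) * (1 + x) := by unfold B1; nlinarith
  have c3 : M * (1 + x) ≤ B2 M x := by unfold B2; nlinarith
  have c4 : B2 M x ≤ (M + 2) * (1 + x) := by unfold B2; nlinarith
  have key : ∀ B : ℝ, M * (1 + x) ≤ B → B ≤ (M + 2) * (1 + x) → 
      1 / (M + 2) * (1 / (1 + x) ^ 2) ≤ 1 / ((1 + x) * B) ∧
      1 / ((1 + x) * B) ≤ 1 / M * (1 / (1 + x) ^ 2) := by
    intro B hB1 hB2
    have hB : 0 < B := lt_of_lt_of_le (by positivity) hB1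
    rw [one_div_mul_one_div, one_div_mul_one_div]
    constructor
    · apply one_div_le_one_div_of_le (by positivity)
      nlinarith
    · apply one_div_le_one_div_of_le (by positivity)
      nlinarith
  obtain ⟨k1, k2⟩ := key _ c1 c2
  obtain ⟨k3, k4⟩ := key _ c3 c4
  have e1 : 1 / (2 * M + s3 + x) ≤ 1 / (2 * M) :=
    one_div_le_one_div_of_le (by linarith) (by linarith)
  have e2 : 1 / (2 * M + s3 - x) ≤ 1 / (2 * M) :=
    one_div_le_one_div_of_le (by linarith) (by linarith)
  have e3 : 1 / (2 * (M + 2)) ≤ 1 / (2 * M + s3 + x) :=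
    one_div_le_one_div_of_le (by linarith) (by linarith)
  have e4 : 1 / (2 * (M + 2)) ≤ 1 / (2 * M + s3 - x) :=
    one_div_le_one_div_of_le (by linarith) (by linarith)
  have f1 : 1 / (2 * M) = 1 / M / 2 := by rw [div_div, mul_comm]
  have f2 : 1 / (2 * (M + 2)) = 1 / (M + 2) / 2 := by rw [div_div, mul_comm]
  have f3 : 2 / M * (1 / (1 + x) ^ 2) = 2 * (1 / M * (1 / (1 + x) ^ 2)) := by ring
  have f4 : 2 / (M + 2) * (1 / (1 + x) ^ 2) = 2 * (1 / (M + 2) * (1 / (1 + x) ^ 2)) := by ring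
  unfold tailsum
  constructor <;> linarith

/-! ### The truncated transfer operator -/

noncomputable def Lk (m : ℕ) (φ : ℝ → ℝ) (x : ℝ) : ℝ := ∑ d ∈ Dg m, gw d x * φ (h d x)

def Good (φ : ℝ → ℝ) (B M : ℝ) : Prop :=
  ∀ x ∈ Ioo (0 : ℝ) 1, |φ x| ≤ B ∧ ∃ D, HasDerivAt φ D x ∧ |D| ≤ M

lemma Good.B_nonneg {φ : ℝ → ℝ} {B M : ℝ} (hg : Good φ B M) : 0 ≤ B :=
  (abs_nonneg _).trans (hg (1 / 2) (by norm_num)).1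

lemma Good.M_nonneg {φ : ℝ → ℝ} {B M : ℝ} (hg : Good φ B M) : 0 ≤ M := by
  obtain ⟨-, D, -, hD⟩ := hg (1 / 2) (by norm_num)
  exact (abs_nonneg _).trans hD

lemma Good.lip {φ : ℝ → ℝ} {B M : ℝ} (hg : Good φ B M) {x y : ℝ} (hx : x ∈ Ioo (0 : ℝ) 1)
    (hy : y ∈ Ioo (0 : ℝ) 1) : |φ y - φ x| ≤ M * |y - x| := by
  have := (convex_Ioo (0 : ℝ) 1).norm_image_sub_le_of_norm_deriv_le (𝕜 := ℝ) (f := φ) (C := M)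
    (fun z hz => (by obtain ⟨-, D, h1, -⟩ := hg z hz; exact h1.differentiableAt))
    (fun z hz => (by obtain ⟨-, D, h1, h2⟩ := hg z hz; rw [h1.deriv]; exact h2)) hx hy
  simpa only [Real.norm_eq_abs] using this

lemma Good.continuousOn {φ : ℝ → ℝ} {B M : ℝ} (hg : Good φ B M) :
    ContinuousOn φ (Ioo (0 : ℝ) 1) := fun x hx => by
  obtain ⟨-, D, h1, -⟩ := hg x hx
  exact h1.continuousAt.continuousWithinAt

lemma tailsum_pos {M x : ℝ} (hM : 1 ≤ M) (hx : x ∈ Ioo (0 : ℝ) 1) : 0 < tailsum M x := by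
  refine lt_of_lt_of_le ?_ (tailsum_bounds hM hx).1
  have := hx.1
  positivity

lemma epsf_nonneg (m : ℕ) {x : ℝ} (hx : x ∈ Ioo (0 : ℝ) 1) : 0 ≤ epsf m x := by
  have h1 := uu_pos hx
  have hm : (0 : ℝ) ≤ m := Nat.cast_nonneg m
  have h2 := tailsum_pos (M := (m : ℝ) + 1) (by linarith) hx
  unfold epsf
  positivity

lemma Dg_valid {m : ℕ} {d : Digit} (hd : d ∈ Dg m) : d.Valid := ((mem_Dg m d).1 hd).1

lemma sum_gw_le (m : ℕ) {x : ℝ} (hx : x ∈ Ioo (0 : ℝ) 1) : ∑ d ∈ Dg m, gw d x ≤ 1 := by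
  rw [sum_gw m hx]; linarith [epsf_nonneg m hx]

lemma Good.Lk {φ : ℝ → ℝ} {B M : ℝ} (hg : Good φ B M) (m : ℕ) :
    Good (Lk m φ) B (99 / 100 * M + 30 * B / ((m : ℝ) + 1)) := by
  intro x hx
  have hB := hg.B_nonneg
  have hM := hg.M_nonneg
  have hm : (0 : ℝ) ≤ m := Nat.cast_nonneg m
  refine ⟨?_, ?_⟩
  · calc |SCF.Lk m φ x| ≤ ∑ d ∈ Dg m, |gw d x * φ (h d x)| := Finset.abs_sum_le_sum_abs _ _
      _ ≤ ∑ d ∈ Dg m, gw d x * B := by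
        apply Finset.sum_le_sum
        intro d hd
        have hv := Dg_valid hd
        rw [abs_mul, abs_of_pos (gw_pos hv hx)]
        exact mul_le_mul_of_nonneg_left (hg _ (h_pos_side hv hx).1).1 (gw_pos hv hx).le
      _ = (∑ d ∈ Dg m, gw d x) * B := by rw [Finset.sum_mul]
      _ ≤ 1 * B := mul_le_mul_of_nonneg_right (sum_gw_le m hx) hB
      _ = B := one_mul B
  · obtain ⟨E, hE, hEb⟩ := epsf_deriv m hx
    set c := φ (1 / 2) with hc
    have hcB : |c| ≤ B := (hg (1 / 2) (by norm_num)).1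
    have hhalf : (1 / 2 : ℝ) ∈ Ioo (0 : ℝ) 1 := by norm_num
    have key : ∀ d ∈ Dg m, ∃ F, HasDerivAt (fun z => gw d z * (φ (h d z) - c)) F x ∧
        |F| ≤ gw d x * (99 / 100 * M) := by
      intro d hd
      have hv := Dg_valid hd
      have hh := (h_pos_side hv hx).1
      obtain ⟨-, D, hD, hDM⟩ := hg _ hh
      refine ⟨_, (hasDerivAt_gw hv hx).fun_mul ((hD.comp x (hasDerivAt_h hv hx)).sub_const c), ?_⟩
      have hl := hg.lip hhalf hh
      have hcon := contraction hv hx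
      have hgp := gw_pos hv hx
      have hdn := den_pos hv hx
      rw [show gw d x * Rr d x * (φ (h d x) - c) +
          gw d x * (D * ((cA d * cE d - cB d * cC d) / den d x ^ 2)) =
          gw d x * (Rr d x * (φ (h d x) - c) + D * ((cA d * cE d - cB d * cC d) / den d x ^ 2)) by
          ring, abs_mul, abs_of_pos hgp]
      apply mul_le_mul_of_nonneg_left _ hgp.le
      refine (abs_add_le _ _).trans ?_
      rw [abs_mul, abs_mul, abs_div, det_abs hv, abs_of_pos (by positivity : 0 < den d x ^ 2)]
      have t1 : |Rr d x| * |φ (h d x) - c| ≤ |Rr d x| * (M * |h d x - 1 / 2|) :=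
        mul_le_mul_of_nonneg_left hl (abs_nonneg _)
      have t2 : |D| * (1 / den d x ^ 2) ≤ M * (1 / den d x ^ 2) :=
        mul_le_mul_of_nonneg_right hDM (by positivity)
      have t3 := mul_le_mul_of_nonneg_left hcon hM
      nlinarith
    choose! F hF hFb using key
    refine ⟨-(c * E) + ∑ d ∈ Dg m, F d, ?_, ?_⟩
    · have h1 : HasDerivAt (fun z => c * (1 - epsf m z) + ∑ d ∈ Dg m, gw d z * (φ (h d z) - c))
          (c * (-E) + ∑ d ∈ Dg m, F d) x :=
        ((hE.const_sub 1).const_mul c).fun_add (HasDerivAt.fun_sum hF)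
      rw [mul_neg] at h1
      refine h1.congr_of_eventuallyEq ?_
      filter_upwards [Ioo_mem_nhds hx.1 hx.2] with z hz
      rw [← sum_gw m hz, Finset.mul_sum, ← Finset.sum_add_distrib]
      apply Finset.sum_congr rfl
      intro d _
      ring
    · refine (abs_add_le _ _).trans ?_
      rw [abs_neg, abs_mul]
      have t1 : |c| * |E| ≤ B * (30 / ((m : ℝ) + 1)) :=
        mul_le_mul hcB hEb (abs_nonneg _) hB
      have t2 : |∑ d ∈ Dg m, F d| ≤ 99 / 100 * M := by
        calc |∑ d ∈ Dg m, F d| ≤ ∑ d ∈ Dg m, |F d| := Finset.abs_sum_le_sum_abs _ _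
          _ ≤ ∑ d ∈ Dg m, gw d x * (99 / 100 * M) := Finset.sum_le_sum hFb
          _ = (∑ d ∈ Dg m, gw d x) * (99 / 100 * M) := by rw [Finset.sum_mul]
          _ ≤ 1 * (99 / 100 * M) :=
            mul_le_mul_of_nonneg_right (sum_gw_le m hx) (by positivity)
          _ = _ := one_mul _
      have : B * (30 / ((m : ℝ) + 1)) = 30 * B / ((m : ℝ) + 1) := by ring
      linarith

lemma Good.iter {φ : ℝ → ℝ} {B M : ℝ} (hg : Good φ B M) (m n : ℕ) :
    Good ((SCF.Lk m)^[n] φ) B ((99 / 100) ^ n * M + 3000 * B / ((m : ℝ) + 1)) := by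
  induction n with
  | zero =>
    intro x hx
    obtain ⟨h1, D, h2, h3⟩ := hg x hx
    have hB := hg.B_nonneg
    refine ⟨h1, D, h2, h3.trans ?_⟩
    have : 0 ≤ 3000 * B / ((m : ℝ) + 1) := by positivity
    simpa using this
  | succ n ih =>
    rw [Function.iterate_succ_apply']
    convert! ih.Lk m using 1
    ring

/-! ### Integral identities -/

lemma uu_ge_one {x : ℝ} (hx : x ∈ Icc (0 : ℝ) 1) : 1 ≤ uu x := by
  have := s3_gt
  have := s3_lt
  obtain ⟨h0, h1⟩ := hx
  rw [uu_eq]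
  nlinarith

lemma continuous_uu : Continuous uu :=
  continuous_iff_continuousAt.2 fun x => (hasDerivAt_uu x).continuousAt

lemma fdens_pos {x : ℝ} (hx : x ∈ Icc (0 : ℝ) 1) : 0 < fdens x := by
  rw [fdens_eq]
  have := uu_ge_one hx
  have := LL_pos
  positivity

lemma fdens_le {x : ℝ} (hx : x ∈ Icc (0 : ℝ) 1) : fdens x ≤ 2 / LL := by
  rw [fdens_eq]
  have h1 := uu_ge_one hx
  have h2 := LL_pos
  apply div_le_div_of_nonneg_left (by norm_num) h2
  nlinarith

lemma continuousOn_fdens : ContinuousOn fdens (Icc 0 1) := by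
  have : fdens = fun x => 2 / (LL * uu x) := funext fdens_eq
  rw [this]
  refine continuousOn_const.div (continuous_const.mul continuous_uu).continuousOn ?_
  intro x hx
  have h1 := uu_ge_one hx
  have h2 := LL_pos
  positivity

lemma integrableOn_bdd {f : ℝ → ℝ} (hf : ContinuousOn f (Ioo (0 : ℝ) 1)) {C : ℝ}
    (hC : ∀ x ∈ Ioo (0 : ℝ) 1, |f x| ≤ C) : IntegrableOn f (Ioo (0 : ℝ) 1) := by
  refine ⟨hf.aestronglyMeasurable measurableSet_Ioo, .restrict_of_bounded (C := C) (by simp) ?_⟩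
  filter_upwards [ae_restrict_mem measurableSet_Ioo] with x hx
  exact hC x hx

lemma Good.integrableOn {φ : ℝ → ℝ} {B M : ℝ} (hg : Good φ B M) :
    IntegrableOn (fun x => φ x * fdens x) (Ioo (0 : ℝ) 1) := by
  refine integrableOn_bdd (hg.continuousOn.mul (continuousOn_fdens.mono Ioo_subset_Icc_self))
    (C := B * (2 / LL)) fun x hx => ?_
  have hx' := Ioo_subset_Icc_self hx
  rw [abs_mul, abs_of_pos (fdens_pos hx')]
  exact mul_le_mul (hg x hx).1 (fdens_le hx') (fdens_pos hx').le hg.B_nonneg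

lemma good_const (c : ℝ) : Good (fun _ => c) |c| 0 := fun x _ =>
  ⟨le_rfl, 0, hasDerivAt_const x c, by simp⟩

lemma integrableOn_fdens : IntegrableOn fdens (Ioo (0 : ℝ) 1) := by
  simpa using (good_const 1).integrableOn

lemma h_image_subset {m n : ℕ} {d : Digit} (hv : d.Valid) : h d '' Sv m n ⊆ Ioo (0 : ℝ) 1 := by
  rintro _ ⟨x, hx, rfl⟩
  exact (h_pos_side hv (Sv_subset m n hx)).1

lemma transfer {φ : ℝ → ℝ} {B M : ℝ} (hg : Good φ B M) (m n : ℕ) :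
    ∫ x in Sv m (n + 1), φ x * fdens x = ∫ x in Sv m n, Lk m φ x * fdens x := by
  have hcv : ∀ d ∈ Dg m, ∀ x ∈ Sv m n, HasDerivWithinAt (h d)
      ((cA d * cE d - cB d * cC d) / den d x ^ 2) (Sv m n) x := fun d hd x hx =>
    (hasDerivAt_h (Dg_valid hd) (Sv_subset m n hx)).hasDerivWithinAt
  have hin : ∀ d ∈ Dg m, InjOn (h d) (Sv m n) := fun d hd =>
    (h_injOn (Dg_valid hd)).mono (Sv_subset m n)
  have hmS := measurableSet_Sv m n
  have hintg : ∀ d ∈ Dg m, IntegrableOn (fun x => φ x * fdens x) (h d '' Sv m n) := fun d hd =>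
    hg.integrableOn.mono_set (h_image_subset (Dg_valid hd))
  have hpt : ∀ d ∈ Dg m, ∀ x ∈ Sv m n,
      |(cA d * cE d - cB d * cC d) / den d x ^ 2| • (φ (h d x) * fdens (h d x)) =
      gw d x * φ (h d x) * fdens x := fun d hd x hx => by
    have := fdens_h (Dg_valid hd) (Sv_subset m n hx)
    rw [smul_eq_mul]
    linear_combination φ (h d x) * this
  rw [Sv_succ, integral_biUnion_finset (Dg m) _ (Sv_disjoint m n) hintg]
  · have : ∀ x, Lk m φ x * fdens x = ∑ d ∈ Dg m, gw d x * φ (h d x) * fdens x := fun x => by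
      rw [Lk, Finset.sum_mul]
    simp only [this]
    rw [integral_finsetSum]
    · apply Finset.sum_congr rfl
      intro d hd
      rw [integral_image_eq_integral_abs_deriv_smul hmS (hcv d hd) (hin d hd)]
      exact setIntegral_congr_fun hmS (hpt d hd)
    · intro d hd
      have := (integrableOn_image_iff_integrableOn_abs_deriv_smul hmS (hcv d hd) (hin d hd) _).1
        (hintg d hd)
      exact this.congr_fun (hpt d hd) hmS
  · intro d hd
    exact hmS.image_of_continuousOn_injOn (fun x hx => (hcv d hd x hx).continuousWithinAt) (hin d hd)

lemma Sv_zero_ae (m : ℕ) : Sv m 0 =ᵐ[volume] Ioo (0 : ℝ) 1 := by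
  rw [Sv_zero]
  have : ∀ᵐ x : ℝ, Irrational x := by
    rw [ae_iff]
    have : {x : ℝ | ¬ Irrational x} = Set.range ((↑) : ℚ → ℝ) := by
      ext x; simp [Irrational]
    rw [this]
    exact (Set.countable_range _).measure_zero _
  filter_upwards [this] with x hx
  apply propext
  exact ⟨fun hh => hh.1, fun hh => ⟨hh, hx⟩⟩

lemma transfer_iter (m n : ℕ) : ∀ {φ : ℝ → ℝ} {B M : ℝ} (_ : Good φ B M),
    ∫ x in Sv m n, φ x * fdens x = ∫ x in Ioo (0 : ℝ) 1, (Lk m)^[n] φ x * fdens x := by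
  induction n with
  | zero =>
    intro φ B M hg
    exact setIntegral_congr_set (Sv_zero_ae m)
  | succ n ih =>
    intro φ B M hg
    rw [transfer hg, ih (hg.Lk m), Function.iterate_succ_apply]

lemma integral_fdens : ∫ x in Ioo (0 : ℝ) 1, fdens x = 1 := by
  have s1 := s3_gt
  have s2 := s3_lt
  have hL := LL_pos
  rw [← integral_Ioc_eq_integral_Ioo, ← intervalIntegral.integral_of_le zero_le_one]
  have hd : ∀ x ∈ uIcc (0 : ℝ) 1, HasDerivAt
      (fun x => (Real.log (1 + s3 * x) - Real.log (1 - (2 - s3) * x)) / LL) (fdens x) x := by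
    intro x hx
    rw [uIcc_of_le zero_le_one] at hx
    obtain ⟨h0, h1⟩ := hx
    have n1 : 0 < 1 - (2 - s3) * x := by nlinarith
    have n2 : 0 < 1 + s3 * x := by positivity
    have d1 : HasDerivAt (fun x => 1 + s3 * x) (s3 * 1) x :=
      ((hasDerivAt_id x).const_mul s3).const_add 1
    have d2 : HasDerivAt (fun x => 1 - (2 - s3) * x) (-((2 - s3) * 1)) x :=
      ((hasDerivAt_id x).const_mul (2 - s3)).const_sub 1
    have := ((d1.log n2.ne').fun_sub (d2.log n1.ne')).div_const LL
    convert! this using 1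
    rw [fdens_eq, uu, div_sub_div _ _ n2.ne' n1.ne', div_div, div_eq_div_iff (by positivity) (by positivity)]
    ring
  rw [intervalIntegral.integral_eq_sub_of_hasDerivAt hd]
  · simp only [mul_one, mul_zero, add_zero, sub_zero, Real.log_one, zero_div]
    rw [← Real.log_div (by positivity) (by linarith)]
    have : (1 + s3) / (1 - (2 - s3)) = 2 + s3 := by
      rw [div_eq_iff (by linarith)]
      linear_combination (-1 : ℝ) * s3_sq
    rw [this]
    exact div_self hL.ne'
  · apply ContinuousOn.intervalIntegrable
    rw [uIcc_of_le zero_le_one]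
    exact continuousOn_fdens

/-- The measure of the points whose first digit is too large. -/
noncomputable def qm (m : ℕ) : ℝ := ∫ x in Ioo (0 : ℝ) 1, epsf m x * fdens x

lemma integrableOn_epsf (m : ℕ) : IntegrableOn (fun x => epsf m x * fdens x) (Ioo (0 : ℝ) 1) := by
  have hc : ContinuousOn (epsf m) (Ioo (0 : ℝ) 1) := fun x hx => by
    obtain ⟨D, hD, -⟩ := epsf_deriv m hx
    exact hD.continuousAt.continuousWithinAt
  refine integrableOn_bdd (hc.mul (continuousOn_fdens.mono Ioo_subset_Icc_self))
    (C := 1 * (2 / LL)) fun x hx => ?_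
  have hx' := Ioo_subset_Icc_self hx
  rw [abs_mul, abs_of_pos (fdens_pos hx'), abs_of_nonneg (epsf_nonneg m hx)]
  refine mul_le_mul ?_ (fdens_le hx') (fdens_pos hx').le zero_le_one
  have h1 := sum_gw m hx
  have h2 : 0 ≤ ∑ d ∈ Dg m, gw d x := Finset.sum_nonneg fun d hd => (gw_pos (Dg_valid hd) hx).le
  linarith

lemma integral_Sv_one (m : ℕ) : ∫ x in Sv m 1, fdens x = 1 - qm m := by
  have h1 := transfer_iter m 1 (good_const 1)
  simp only [one_mul, Function.iterate_one] at h1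
  have h2 := integral_sub integrableOn_fdens (integrableOn_epsf m)
  rw [integral_fdens] at h2
  rw [h1, qm, ← h2]
  apply setIntegral_congr_fun measurableSet_Ioo
  intro x hx
  simp only [Lk, mul_one]
  rw [sum_gw m hx]
  ring

lemma qm_nonneg (m : ℕ) : 0 ≤ qm m :=
  setIntegral_nonneg measurableSet_Ioo fun x hx =>
    mul_nonneg (epsf_nonneg m hx) (fdens_pos (Ioo_subset_Icc_self hx)).le

lemma qm_le_one (m : ℕ) : qm m ≤ 1 := by
  have : 0 ≤ ∫ x in Sv m 1, fdens x := setIntegral_nonneg (measurableSet_Sv m 1) fun x hx =>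
    (fdens_pos (Ioo_subset_Icc_self (Sv_subset m 1 hx))).le
  rw [integral_Sv_one] at this
  linarith

lemma integral_model (c : ℝ) : IntegrableOn (fun x : ℝ => c * (1 + 2 * (1 / (1 + x) ^ 2))) (Ioo 0 1)
    ∧ ∫ x in Ioo (0 : ℝ) 1, c * (1 + 2 * (1 / (1 + x) ^ 2)) = c * 2 := by
  have hc : ContinuousOn (fun x : ℝ => 1 + 2 * (1 / (1 + x) ^ 2)) (Icc 0 1) := by
    intro x hx
    have : 0 < (1 + x) ^ 2 := by have := hx.1; positivity
    apply ContinuousAt.continuousWithinAt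
    fun_prop (disch := exact this.ne')
  have hi : IntegrableOn (fun x : ℝ => 1 + 2 * (1 / (1 + x) ^ 2)) (Ioo 0 1) :=
    (hc.integrableOn_compact isCompact_Icc).mono_set Ioo_subset_Icc_self
  refine ⟨hi.const_mul c, ?_⟩
  rw [integral_const_mul]
  congr 1
  rw [← integral_Ioc_eq_integral_Ioo, ← intervalIntegral.integral_of_le zero_le_one]
  have hd : ∀ x ∈ uIcc (0 : ℝ) 1, HasDerivAt (fun x : ℝ => x - 2 * (1 / (1 + x)))
      (1 + 2 * (1 / (1 + x) ^ 2)) x := by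
    intro x hx
    rw [uIcc_of_le zero_le_one] at hx
    have h0 : 0 < 1 + x := by linarith [hx.1]
    have d0 : HasDerivAt (fun x : ℝ => 1 + x) 1 x := (hasDerivAt_id x).const_add 1
    have := (hasDerivAt_id x).fun_sub (((hasDerivAt_const x (1 : ℝ)).fun_div d0 h0.ne').const_mul 2)
    convert! this using 1
    ring
  rw [intervalIntegral.integral_eq_sub_of_hasDerivAt hd]
  · norm_num
  · apply ContinuousOn.intervalIntegrable
    rw [uIcc_of_le zero_le_one]
    exact hc

lemma qm_bounds (m : ℕ) : 2 / LL / ((m : ℝ) + 3) ≤ qm m ∧ qm m ≤ 2 / LL / ((m : ℝ) + 1) := by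
  have hL := LL_pos
  have hm : (0 : ℝ) ≤ m := Nat.cast_nonneg m
  have e : ∀ x ∈ Ioo (0 : ℝ) 1, epsf m x * fdens x = 1 / LL * tailsum ((m : ℝ) + 1) x := by
    intro x hx
    have := uu_pos hx
    rw [epsf, fdens_eq]
    field_simp
  have t : ∀ x ∈ Ioo (0 : ℝ) 1, _ := fun x hx =>
    tailsum_bounds (M := (m : ℝ) + 1) (by linarith) hx
  constructor
  · obtain ⟨i1, i2⟩ := integral_model (1 / LL / ((m : ℝ) + 3))
    calc _ = 1 / LL / ((m : ℝ) + 3) * 2 := by ring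
      _ = _ := i2.symm
      _ ≤ qm m := by
        apply setIntegral_mono_on i1 (integrableOn_epsf m) measurableSet_Ioo
        intro x hx
        rw [e x hx]
        refine le_trans (le_of_eq ?_) (mul_le_mul_of_nonneg_left (t x hx).1 (by positivity))
        rw [show (m : ℝ) + 1 + 2 = m + 3 by ring]
        ring
  · obtain ⟨i1, i2⟩ := integral_model (1 / LL / ((m : ℝ) + 1))
    calc qm m ≤ _ := by
          apply setIntegral_mono_on (integrableOn_epsf m) i1 measurableSet_Ioo
          intro x hx
          rw [e x hx]
          refine le_trans (mul_le_mul_of_nonneg_left (t x hx).2 (by positivity)) (le_of_eq ?_)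
          ring
      _ = _ := i2
      _ = _ := by ring

/-! ### One step of the recursion and the limit for smooth densities -/

lemma Good.osc {φ : ℝ → ℝ} {B M : ℝ} (hg : Good φ B M) {x : ℝ} (hx : x ∈ Ioo (0 : ℝ) 1) :
    |φ x - ∫ y in Ioo (0 : ℝ) 1, φ y * fdens y| ≤ M := by
  have hM := hg.M_nonneg
  have e1 : φ x = ∫ y in Ioo (0 : ℝ) 1, φ x * fdens y := by
    rw [integral_const_mul, integral_fdens, mul_one]
  have e2 : φ x - ∫ y in Ioo (0 : ℝ) 1, φ y * fdens y
      = ∫ y in Ioo (0 : ℝ) 1, (φ x * fdens y - φ y * fdens y) := by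
    rw [integral_sub (integrableOn_fdens.const_mul _) hg.integrableOn, ← e1]
  have e3 : ∫ y in Ioo (0 : ℝ) 1, M * fdens y = M := by
    rw [integral_const_mul, integral_fdens, mul_one]
  rw [e2, ← Real.norm_eq_abs]
  refine (norm_integral_le_of_norm_le (g := fun y => M * fdens y)
    (integrableOn_fdens.const_mul M) ?_).trans e3.le
  filter_upwards [ae_restrict_mem measurableSet_Ioo] with y hy
  have hf := fdens_pos (Ioo_subset_Icc_self hy)
  rw [← sub_mul, Real.norm_eq_abs, abs_mul, abs_of_pos hf]
  apply mul_le_mul_of_nonneg_right _ hf.le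
  refine (hg.lip hy hx).trans ?_
  have : |x - y| ≤ 1 := by
    rw [abs_le]; constructor <;> linarith [hx.1, hx.2, hy.1, hy.2]
  nlinarith

lemma Good.step {φ : ℝ → ℝ} {B M : ℝ} (hg : Good φ B M) (m : ℕ) :
    |(∫ x in Sv m 1, φ x * fdens x) - (1 - qm m) * ∫ x in Ioo (0 : ℝ) 1, φ x * fdens x|
      ≤ M * qm m := by
  set p := ∫ x in Ioo (0 : ℝ) 1, φ x * fdens x with hp
  have hS := measurableSet_Sv m 1
  have hsub := Sv_subset m 1
  have hC : MeasurableSet (Ioo (0 : ℝ) 1 \ Sv m 1) := measurableSet_Ioo.diff hS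
  have hCs : Ioo (0 : ℝ) 1 \ Sv m 1 ⊆ Ioo (0 : ℝ) 1 := Set.sdiff_subset
  have c1 : ∫ x in Ioo (0 : ℝ) 1 \ Sv m 1, fdens x = qm m := by
    rw [setIntegral_sdiff hS integrableOn_fdens hsub, integral_fdens, integral_Sv_one]
    ring
  have c2 : ∫ x in Ioo (0 : ℝ) 1 \ Sv m 1, φ x * fdens x = p - ∫ x in Sv m 1, φ x * fdens x :=
    setIntegral_sdiff hS hg.integrableOn hsub
  have c3 : ∫ x in Ioo (0 : ℝ) 1 \ Sv m 1, (φ x * fdens x - p * fdens x)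
      = p - (∫ x in Sv m 1, φ x * fdens x) - p * qm m := by
    rw [integral_sub (hg.integrableOn.mono_set hCs)
      ((integrableOn_fdens.mono_set hCs).const_mul p), c2, integral_const_mul, c1]
  have c4 : |∫ x in Ioo (0 : ℝ) 1 \ Sv m 1, (φ x * fdens x - p * fdens x)| ≤ M * qm m := by
    have e3 : ∫ x in Ioo (0 : ℝ) 1 \ Sv m 1, M * fdens x = M * qm m := by
      rw [integral_const_mul, c1]
    rw [← Real.norm_eq_abs]
    refine (norm_integral_le_of_norm_le (g := fun y => M * fdens y)
      ((integrableOn_fdens.mono_set hCs).const_mul M) ?_).trans e3.le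
    filter_upwards [ae_restrict_mem hC] with y hy
    have hf := fdens_pos (Ioo_subset_Icc_self (hCs hy))
    rw [← sub_mul, Real.norm_eq_abs, abs_mul, abs_of_pos hf]
    exact mul_le_mul_of_nonneg_right (hg.osc (hCs hy)) hf.le
  rw [c3, ← abs_neg] at c4
  convert! c4 using 2
  ring

lemma Good.recursion {φ : ℝ → ℝ} {B M : ℝ} (hg : Good φ B M) (m N : ℕ) :
    |(∫ x in Sv m N, φ x * fdens x) - (1 - qm m) ^ N * ∫ x in Ioo (0 : ℝ) 1, φ x * fdens x|
      ≤ qm m * (100 * M * (1 - (99 / 100) ^ N) + N * (3000 * B / ((m : ℝ) + 1))) := by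
  have q0 := qm_nonneg m
  have q1 := qm_le_one m
  induction N with
  | zero =>
    rw [transfer_iter m 0 hg]
    simp
  | succ N ih =>
    have hs := (hg.iter m N).step m
    have ht := transfer_iter m 1 (hg.iter m N)
    rw [Function.iterate_one, ← Function.iterate_succ_apply' (SCF.Lk m) N φ,
      ← transfer_iter m (N + 1) hg] at ht
    rw [ht, ← transfer_iter m N hg] at hs
    set P1 := ∫ x in Sv m (N + 1), φ x * fdens x
    set P := ∫ x in Sv m N, φ x * fdens x
    set p := ∫ x in Ioo (0 : ℝ) 1, φ x * fdens x
    have e : P1 - (1 - qm m) ^ (N + 1) * p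
        = (P1 - (1 - qm m) * P) + (1 - qm m) * (P - (1 - qm m) ^ N * p) := by ring
    rw [e]
    refine (abs_add_le _ _).trans ?_
    rw [abs_mul, abs_of_nonneg (sub_nonneg.2 q1)]
    have t1 : (1 - qm m) * |P - (1 - qm m) ^ N * p| ≤ 1 * |P - (1 - qm m) ^ N * p| :=
      mul_le_mul_of_nonneg_right (by linarith) (abs_nonneg _)
    have t2 := add_le_add hs (t1.trans ((one_mul _).le.trans ih))
    refine t2.trans (le_of_eq ?_)
    push_cast
    ring

/-- The truncation level. -/
noncomputable def lev (y : ℝ) (N : ℕ) : ℕ := ⌊2 / LL * y * (N : ℝ)⌋₊ - 1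

lemma lev_eventually {y : ℝ} (hy : 0 < y) :
    ∀ᶠ N : ℕ in atTop, ((lev y N : ℝ) + 1 = (⌊2 / LL * y * (N : ℝ)⌋₊ : ℝ)) := by
  have hL := LL_pos
  have hc : 0 < 2 / LL * y := by positivity
  have h1 : Tendsto (fun N : ℕ => 2 / LL * y * (N : ℝ)) atTop atTop :=
    tendsto_natCast_atTop_atTop.const_mul_atTop hc
  filter_upwards [h1.eventually_ge_atTop 1] with N hN
  have h2 : 1 ≤ ⌊2 / LL * y * (N : ℝ)⌋₊ := Nat.le_floor (by simpa using hN)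
  rw [lev]
  push_cast [h2]
  ring

lemma lev_div {y : ℝ} (hy : 0 < y) :
    Tendsto (fun N : ℕ => ((lev y N : ℝ) + 1) / N) atTop (𝓝 (2 / LL * y)) := by
  have hL := LL_pos
  have := (tendsto_nat_floor_mul_div_atTop (R := ℝ) (a := 2 / LL * y) (by positivity)).comp
    tendsto_natCast_atTop_atTop
  refine this.congr' ?_
  filter_upwards [lev_eventually hy] with N hN
  rw [hN]
  rfl

lemma tendsto_N_q {y : ℝ} (hy : 0 < y) :
    Tendsto (fun N : ℕ => (N : ℝ) * qm (lev y N)) atTop (𝓝 (1 / y)) := by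
  have hL := LL_pos
  have hc : 2 / LL * y ≠ 0 := by positivity
  have h0 : Tendsto (fun N : ℕ => (2 : ℝ) / N) atTop (𝓝 0) := tendsto_const_div_atTop_nhds_zero_nat 2
  have u1 := (tendsto_const_nhds (x := 2 / LL)).div (lev_div hy) hc
  have l1 := (tendsto_const_nhds (x := 2 / LL)).div ((lev_div hy).add h0) (by simpa using hc)
  have e : 2 / LL / (2 / LL * y) = 1 / y := by field_simp
  rw [add_zero, e] at l1
  rw [e] at u1
  refine tendsto_of_tendsto_of_tendsto_of_le_of_le' l1 u1 ?_ ?_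
  · filter_upwards [eventually_gt_atTop 0] with N hN
    have hN' : (0 : ℝ) < N := by exact_mod_cast hN
    have hb := mul_le_mul_of_nonneg_left (qm_bounds (lev y N)).1 hN'.le
    refine le_trans (le_of_eq ?_) hb
    simp only [Pi.div_apply]
    rw [← add_div, show (lev y N : ℝ) + 1 + 2 = lev y N + 3 by ring]
    field_simp
  · filter_upwards [eventually_gt_atTop 0] with N hN
    have hN' : (0 : ℝ) < N := by exact_mod_cast hN
    have hb := mul_le_mul_of_nonneg_left (qm_bounds (lev y N)).2 hN'.le
    refine le_trans hb (le_of_eq ?_)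
    simp only [Pi.div_apply]
    field_simp

lemma Good.limit {φ : ℝ → ℝ} {B M : ℝ} (hg : Good φ B M) {y : ℝ} (hy : 0 < y) :
    Tendsto (fun N : ℕ => ∫ x in Sv (lev y N) N, φ x * fdens x) atTop
      (𝓝 (Real.exp (-1 / y) * ∫ x in Ioo (0 : ℝ) 1, φ x * fdens x)) := by
  have hL := LL_pos
  have hM := hg.M_nonneg
  have hB := hg.B_nonneg
  set p := ∫ x in Ioo (0 : ℝ) 1, φ x * fdens x
  have hq := tendsto_N_q hy
  have hinv : Tendsto (fun N : ℕ => (1 : ℝ) / N) atTop (𝓝 0) :=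
    tendsto_const_div_atTop_nhds_zero_nat 1
  have hq0 : Tendsto (fun N : ℕ => qm (lev y N)) atTop (𝓝 0) := by
    have := hq.mul hinv
    rw [mul_zero] at this
    refine this.congr' ?_
    filter_upwards [eventually_gt_atTop 0] with N hN
    have hN' : (0 : ℝ) < N := by exact_mod_cast hN
    field_simp
  have hpow : Tendsto (fun N : ℕ => (1 - qm (lev y N)) ^ N * p) atTop
      (𝓝 (Real.exp (-1 / y) * p)) := by
    apply Tendsto.mul_const
    have h1 : Tendsto (fun N : ℕ => (N : ℝ) * (-qm (lev y N))) atTop (𝓝 (-1 / y)) := by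
      have := hq.neg
      rw [← neg_div] at this
      simpa using this
    have := Real.tendsto_one_add_pow_exp_of_tendsto h1
    simpa only [← sub_eq_add_neg] using this
  have hNm : Tendsto (fun N : ℕ => (N : ℝ) * (3000 * B / ((lev y N : ℝ) + 1))) atTop
      (𝓝 (3000 * B / (2 / LL * y))) := by
    have := (tendsto_const_nhds (x := 3000 * B)).div (lev_div hy) (by positivity)
    refine this.congr' ?_
    filter_upwards [eventually_gt_atTop 0] with N hN
    have hN' : (0 : ℝ) < N := by exact_mod_cast hN
    simp only [Pi.div_apply]
    field_simp
  have herr : Tendsto (fun N : ℕ => qm (lev y N) * (100 * M +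
      (N : ℝ) * (3000 * B / ((lev y N : ℝ) + 1)))) atTop (𝓝 0) := by
    have := hq0.mul (hNm.const_add (100 * M))
    rwa [zero_mul] at this
  have hdiff : Tendsto (fun N : ℕ => (∫ x in Sv (lev y N) N, φ x * fdens x)
      - (1 - qm (lev y N)) ^ N * p) atTop (𝓝 0) := by
    refine squeeze_zero_norm (fun N => ?_) herr
    rw [Real.norm_eq_abs]
    refine (hg.recursion (lev y N) N).trans ?_
    apply mul_le_mul_of_nonneg_left _ (qm_nonneg _)
    have : (0 : ℝ) ≤ (99 / 100) ^ N := by positivity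
    nlinarith
  have := hdiff.add hpow
  simpa using this

lemma set_eq {y : ℝ} (hy : 0 < y) : ∀ᶠ N : ℕ in atTop,
    {x : ℝ | x ∈ Set.Ioo (0 : ℝ) 1 ∧ Irrational x ∧
              ∀ n : ℕ, 1 ≤ n → n ≤ N →
                (a n x : ℝ) ≤ (2 / Real.log (2 + Real.sqrt 3)) * N * y} = Sv (lev y N) N := by
  have hL := LL_pos
  filter_upwards [lev_eventually hy] with N hN
  have key : ∀ z : ℤ, (z : ℝ) ≤ (2 / Real.log (2 + Real.sqrt 3)) * N * y ↔ z ≤ (lev y N : ℤ) + 1 := by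
    intro z
    have e : (2 / Real.log (2 + Real.sqrt 3)) * N * y = 2 / LL * y * N := by
      unfold LL; ring
    have e2 : (lev y N : ℤ) + 1 = ⌊2 / LL * y * (N : ℝ)⌋ := by
      rw [← Int.natCast_floor_eq_floor (by positivity)]
      exact_mod_cast hN
    rw [e, e2, Int.le_floor]
  ext x
  simp only [Sv, mem_ofPred_eq, key]

/-! ### General densities -/

lemma good_of_smooth {ξ : ℝ → ℝ} (hξ : ContDiff ℝ 1 ξ) :
    ∃ B M, Good (fun x => ξ x * (LL / 2 * uu x)) B M := by
  have hu : ContDiff ℝ 1 uu := by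
    have hf : uu = fun x => (1 - (2 - s3) * x) * (1 + s3 * x) := rfl
    rw [hf]
    fun_prop
  have hφ : ContDiff ℝ 1 (fun x => ξ x * (LL / 2 * uu x)) := hξ.mul (contDiff_const.mul hu)
  obtain ⟨B, hB⟩ := isCompact_Icc.exists_bound_of_continuousOn (s := Icc (0 : ℝ) 1)
    hφ.continuous.continuousOn
  obtain ⟨M, hM⟩ := isCompact_Icc.exists_bound_of_continuousOn (s := Icc (0 : ℝ) 1)
    (hφ.continuous_deriv le_rfl).continuousOn
  refine ⟨B, M, fun x hx => ⟨hB x (Ioo_subset_Icc_self hx), _,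
    (hφ.differentiable one_ne_zero x).hasDerivAt, hM x (Ioo_subset_Icc_self hx)⟩⟩

lemma smooth_limit {ξ : ℝ → ℝ} (hξ : ContDiff ℝ 1 ξ) {y : ℝ} (hy : 0 < y) :
    Tendsto (fun N : ℕ => ∫ x in Sv (lev y N) N, ξ x) atTop
      (𝓝 (Real.exp (-1 / y) * ∫ x in Ioo (0 : ℝ) 1, ξ x)) := by
  obtain ⟨B, M, hg⟩ := good_of_smooth hξ
  have e : ∀ x ∈ Ioo (0 : ℝ) 1, ξ x * (LL / 2 * uu x) * fdens x = ξ x := fun x hx => by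
    have h1 := uu_pos hx
    have h2 := LL_pos
    rw [fdens_eq]
    field_simp
  have h1 := hg.limit hy
  rw [setIntegral_congr_fun measurableSet_Ioo e] at h1
  refine h1.congr fun N => ?_
  exact setIntegral_congr_fun (measurableSet_Sv _ _) fun x hx => e x (Sv_subset _ _ hx)

lemma density_limit {ρ : ℝ → ℝ} (hρ : Integrable ρ) {y : ℝ} (hy : 0 < y) :
    Tendsto (fun N : ℕ => ∫ x in Sv (lev y N) N, ρ x) atTop
      (𝓝 (Real.exp (-1 / y) * ∫ x in Ioo (0 : ℝ) 1, ρ x)) := by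
  rw [Metric.tendsto_atTop]
  intro ε hε
  obtain ⟨ξ, hc, hs, hb⟩ := (memLp_one_iff_integrable.2 hρ).exist_eLpNorm_sub_le
    ENNReal.one_ne_top le_rfl (show 0 < ε / 4 by positivity)
  have hξi : Integrable ξ := hs.continuous.integrable_of_hasCompactSupport hc
  have hdi : Integrable (ρ - ξ) := hρ.sub hξi
  have hb' : ∫ x, ‖(ρ - ξ) x‖ ≤ ε / 4 := by
    rw [integral_norm_eq_lintegral_enorm hdi.aestronglyMeasurable, ← eLpNorm_one_eq_lintegral_enorm]
    exact ENNReal.toReal_le_of_le_ofReal (by positivity) hb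
  have hS : ∀ S : Set ℝ, |(∫ x in S, ρ x) - ∫ x in S, ξ x| ≤ ε / 4 := fun S => by
    rw [← integral_sub hρ.integrableOn hξi.integrableOn, ← Real.norm_eq_abs]
    refine (norm_integral_le_integral_norm _).trans (le_trans ?_ hb')
    exact setIntegral_le_integral hdi.norm (Eventually.of_forall fun x => norm_nonneg _)
  have hlim := Metric.tendsto_atTop.1 (smooth_limit (hs.of_le (by norm_num)) hy) (ε / 4)
    (by positivity)
  obtain ⟨N₀, hN₀⟩ := hlim
  refine ⟨N₀, fun N hN => ?_⟩
  have h1 := hN₀ N hN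
  rw [Real.dist_eq] at h1 ⊢
  have h2 := hS (Sv (lev y N) N)
  have h3 := hS (Ioo (0 : ℝ) 1)
  set c := Real.exp (-1 / y)
  have hc0 : 0 ≤ c := (Real.exp_pos _).le
  have hc1 : c ≤ 1 := by
    apply Real.exp_le_one_iff.2
    rw [neg_div]
    have : 0 < 1 / y := by positivity
    linarith
  set P := ∫ x in Sv (lev y N) N, ρ x
  set Q := ∫ x in Sv (lev y N) N, ξ x
  set R := ∫ x in Ioo (0 : ℝ) 1, ρ x
  set W := ∫ x in Ioo (0 : ℝ) 1, ξ x
  have h4 : |c * (R - W)| ≤ ε / 4 := by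
    rw [abs_mul, abs_of_nonneg hc0]
    have := abs_nonneg (R - W)
    nlinarith
  rw [abs_le] at h2 h4
  rw [abs_lt] at h1 ⊢
  constructor <;> nlinarith
/-- Galambos' theorem for the SCF digits with respect to any
absolutely continuous Borel probability measure on `(0,1)`. -/
theorem scf_extreme_value_theorem_abs_cont :
    ∀ mu' : Measure ℝ, IsProbabilityMeasure mu' → mu' ≪ volume →
      mu' ((Set.Ioo (0 : ℝ) 1)ᶜ) = 0 →
      ∀ y : ℝ, 0 < y →
        Filter.Tendsto
          (fun N : ℕ =>
            mu' {x : ℝ | x ∈ Set.Ioo (0 : ℝ) 1 ∧ Irrational x ∧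
              ∀ n : ℕ, 1 ≤ n → n ≤ N →
                (a n x : ℝ) ≤ (2 / Real.log (2 + Real.sqrt 3)) * N * y})
          Filter.atTop (nhds (ENNReal.ofReal (Real.exp (-1 / y)))) := by
  intro mu' hprob hac hout y hy
  set ρ : ℝ → ℝ := fun x => (mu'.rnDeriv volume x).toReal with hρ
  have hρi : Integrable ρ := Measure.integrable_toReal_rnDeriv
  have hreal : ∀ S : Set ℝ, ∫ x in S, ρ x = mu'.real S := fun S =>
    Measure.setIntegral_toReal_rnDeriv hac S
  have hone : ∫ x in Ioo (0 : ℝ) 1, ρ x = 1 := by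
    rw [hreal, measureReal_def, (prob_compl_eq_zero_iff measurableSet_Ioo).1 hout]
    simp
  have hlim := density_limit hρi hy
  rw [hone, mul_one] at hlim
  refine (ENNReal.tendsto_ofReal hlim).congr' ?_
  filter_upwards [set_eq hy] with N hN
  rw [hN, hreal, ofReal_measureReal]

end SCF
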